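/- arXiv:math/0308025 — 2 statements merged into one kernel-verified Lean document; each statement's English description precedes it below -/
import Mathlib

section
/- Let p_{0k}, p_{1k} ≥ 0 with p_{0k} + p_{1k} = 1 for all k, and suppose Σ_{k=1}^∞ (1/2 − p_{0k})² < ∞. Then for Lebesgue-almost every λ ∈ [1/2, 1), the distribution of ψ = Σ_{k=1}^∞ ψ_k λ^k is absolutely continuous with respect to Lebesgue measure on ℝ. -/
open MeasureTheory

/-- The Bernoulli measure on `Bool` giving mass `p₀` to `false` (value `0`) and
mass `p₁` to `true` (value `1`). -/
noncomputable def bernoulliMeasure (p₀ p₁ : ℝ) : Measure Bool :=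
  ENNReal.ofReal p₀ • Measure.dirac false + ENNReal.ofReal p₁ • Measure.dirac true

/-- `P` is the infinite product of the measures `μ k` on `Bool`: every
finite-dimensional cylinder set gets the product of the coordinate measures. -/
def IsProductMeasure (μ : ℕ → Measure Bool) (P : Measure (ℕ → Bool)) : Prop :=
  ∀ (s : Finset ℕ) (E : ℕ → Set Bool),
    P {ω | ∀ k ∈ s, ω k ∈ E k} = ∏ k ∈ s, μ k (E k)

open scoped ENNReal Topology

lemma ac_of_liminf (μ : Measure ℝ) [IsFiniteMeasure μ] (r : ℕ → ℝ) (hr : ∀ n, 0 < r n)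
    (hr0 : Filter.Tendsto r Filter.atTop (𝓝 0))
    (h : ∀ᵐ x ∂μ, Filter.liminf (fun n => μ (Metric.closedBall x (r n)) / ENNReal.ofReal (r n))
      Filter.atTop < ∞) : μ ≪ volume := by
  have hpos : ∀ᵐ x ∂μ, (volume : Measure ℝ).rnDeriv μ x ≠ 0 := by
    filter_upwards [h, Besicovitch.ae_tendsto_rnDeriv (volume : Measure ℝ) μ] with x hx ht hz
    rw [hz] at ht
    have ht' : Filter.Tendsto (fun n => volume (Metric.closedBall x (r n)) /
        μ (Metric.closedBall x (r n))) Filter.atTop (𝓝 0) := by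
      refine ht.comp (tendsto_nhdsWithin_iff.2 ⟨hr0, Filter.Eventually.of_forall hr⟩)
    have ht2 := (continuous_inv (G := ℝ≥0∞)).continuousAt.tendsto.comp ht'
    rw [ENNReal.inv_zero] at ht2
    have hle : ∀ n, ((fun a : ℝ≥0∞ => a⁻¹) ∘ fun n => volume (Metric.closedBall x (r n)) /
        μ (Metric.closedBall x (r n))) n ≤ μ (Metric.closedBall x (r n)) / ENNReal.ofReal (r n) := by
      intro n
      simp only [Function.comp]
      have h2 : ENNReal.ofReal (r n) ≤ ENNReal.ofReal (2 * r n) :=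
        ENNReal.ofReal_le_ofReal (by linarith [hr n])
      rw [Real.volume_closedBall, ENNReal.inv_div (Or.inl (measure_ne_top _ _))
        (Or.inr (by simpa using hr n))]
      gcongr
    have := tendsto_nhds_top_mono' ht2 hle
    rw [this.liminf_eq] at hx
    exact lt_irrefl _ hx
  refine Measure.AbsolutelyContinuous.mk fun s hs hs0 => ?_
  have h1 : ∫⁻ x in s, (volume : Measure ℝ).rnDeriv μ x ∂μ = 0 :=
    le_antisymm ((Measure.setLIntegral_rnDeriv_le s).trans hs0.le) (zero_le)
  rw [lintegral_eq_zero_iff (Measure.measurable_rnDeriv _ _)] at h1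
  have h2 : ∀ᵐ x ∂(μ.restrict s), False := by
    filter_upwards [h1, ae_restrict_of_ae hpos] with x a b using b a
  simpa [Filter.eventually_false_iff_eq_bot] using h2

lemma ac_of_energy {Ω : Type*} [MeasurableSpace Ω] (P : Measure Ω) [IsProbabilityMeasure P]
    (F : ℝ → Ω → ℝ) (hF : Measurable (Function.uncurry F)) (I : Set ℝ)
    (C : ℝ≥0∞) (hC : C ≠ ∞)
    (h : ∀ r : ℝ, 0 < r → ∫⁻ q, volume.restrict I {t | |F t q.1 - F t q.2| ≤ r} ∂(P.prod P) ≤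
      C * ENNReal.ofReal r) :
    ∀ᵐ t ∂(volume.restrict I), P.map (F t) ≪ volume := by
  have hFt : ∀ t, Measurable (F t) := fun t => hF.comp measurable_prodMk_left
  let r : ℕ → ℝ := fun n => 1 / ((n : ℝ) + 1)
  have hr : ∀ n, 0 < r n := fun n => by positivity
  have hr0 : Filter.Tendsto r Filter.atTop (𝓝 0) := tendsto_one_div_add_atTop_nhds_zero_nat
  have hsetm : ∀ n, MeasurableSet {z : (ℝ × Ω) × Ω | |F z.1.1 z.1.2 - F z.1.1 z.2| ≤ r n} := by
    intro n
    refine measurableSet_le ?_ measurable_const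
    have a1 : Measurable fun z : (ℝ × Ω) × Ω => F z.1.1 z.1.2 := hF.comp measurable_fst
    have a2 : Measurable fun z : (ℝ × Ω) × Ω => F z.1.1 z.2 :=
      hF.comp ((measurable_fst.comp measurable_fst).prodMk measurable_snd)
    exact (a1.sub a2).abs
  let G : ℕ → ℝ × Ω → ℝ≥0∞ := fun n z => P {τ | |F z.1 z.2 - F z.1 τ| ≤ r n} / ENNReal.ofReal (r n)
  have hGm : ∀ n, Measurable (G n) := by
    intro n
    exact (measurable_measure_prodMk_left (hsetm n)).div_const _
  have hG : ∀ n, ∫⁻ z, G n z ∂((volume.restrict I).prod P) ≤ C := by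
    intro n
    have e1 : ∫⁻ z, P {τ | |F z.1 z.2 - F z.1 τ| ≤ r n} ∂((volume.restrict I).prod P) =
        ∫⁻ q, volume.restrict I {t | |F t q.1 - F t q.2| ≤ r n} ∂(P.prod P) := by
      have m1 : MeasurableSet {z : ℝ × (Ω × Ω) | |F z.1 z.2.1 - F z.1 z.2.2| ≤ r n} :=
        (hsetm n).preimage MeasurableEquiv.prodAssoc.symm.measurable
      have b1 := Measure.prod_apply_symm (μ := volume.restrict I) (ν := P.prod P) m1
      have b2 := Measure.prod_apply (μ := (volume.restrict I).prod P) (ν := P) (hsetm n)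
      have b3 := (measurePreserving_prodAssoc (volume.restrict I) P P).measure_preimage
        m1.nullMeasurableSet
      refine b2.symm.trans ((Eq.trans ?_ b3).trans b1)
      rfl
    have : ∫⁻ z, G n z ∂((volume.restrict I).prod P) =
        (∫⁻ z, P {τ | |F z.1 z.2 - F z.1 τ| ≤ r n} ∂((volume.restrict I).prod P)) *
          (ENNReal.ofReal (r n))⁻¹ := by
      simp only [G, div_eq_mul_inv]
      exact lintegral_mul_const _ (measurable_measure_prodMk_left (hsetm n))
    rw [this, e1]
    refine (mul_le_mul_left (h _ (hr n)) _).trans ?_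
    rw [mul_assoc, ENNReal.mul_inv_cancel (by simpa using hr n) ENNReal.ofReal_ne_top, mul_one]
  have hlim : ∫⁻ z, Filter.liminf (fun n => G n z) Filter.atTop ∂((volume.restrict I).prod P) ≤ C := by
    refine (lintegral_liminf_le hGm).trans ?_
    refine Filter.liminf_le_of_le (by isBoundedDefault) ?_
    intro b hb
    obtain ⟨n, hn⟩ := hb.exists
    exact hn.trans (hG n)
  have hae := ae_lt_top (Measurable.liminf hGm) (ne_top_of_le_ne_top hC hlim)
  have hae2 := Measure.ae_ae_of_ae_prod hae
  filter_upwards [hae2] with t ht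
  have : IsProbabilityMeasure (P.map (F t)) := Measure.isProbabilityMeasure_map (hFt t).aemeasurable
  refine ac_of_liminf _ r hr hr0 ?_
  have hb : ∀ n, Measurable fun x => P.map (F t) (Metric.closedBall x (r n)) := by
    intro n
    have hm : MeasurableSet {z : ℝ × ℝ | dist z.2 z.1 ≤ r n} :=
      measurableSet_le (by fun_prop) measurable_const
    exact measurable_measure_prodMk_left hm
  rw [ae_map_iff (hFt t).aemeasurable]
  · filter_upwards [ht] with ω hω
    convert hω using 5 with n
    simp only [G]
    rw [Measure.map_apply (hFt t) Metric.isClosed_closedBall.measurableSet]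
    congr 2
    ext τ
    simp [Real.dist_eq, abs_sub_comm]
  · exact measurableSet_lt (Measurable.liminf fun n => (hb n).div_const _) measurable_const

def Transv (T : Set ℕ) (J : Set ℝ) (δ : ℝ) : Prop :=
  ∀ n ∈ T, ∀ b : ℕ → ℝ, (∀ i, |b i| ≤ 1) → b 0 = 1 → (∀ i, n + i ∉ T → b i = 0) →
    ∀ x ∈ J, ∀ y ∈ J, x ≤ y → ∀ ρ : ℝ, |∑' i, b i * x ^ i| ≤ ρ → |∑' i, b i * y ^ i| ≤ ρ →
      δ * (y - x) ≤ 2 * ρ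

lemma summable_coeff {b : ℕ → ℝ} (hb : ∀ i, |b i| ≤ 1) {x : ℝ} (h0 : 0 ≤ x) (h1 : x < 1) :
    Summable fun i => b i * x ^ i := by
  refine Summable.of_norm_bounded (summable_geometric_of_lt_one h0 h1) fun i => ?_
  rw [norm_mul, norm_pow, Real.norm_eq_abs, Real.norm_eq_abs, abs_of_nonneg h0]
  exact mul_le_of_le_one_left (by positivity) (hb i)

lemma transv_core {hc b : ℕ → ℝ} {l : ℕ} {Hx Hy gx gy δ ρ x y : ℝ} (hx : 0 < x) (hxy : x ≤ y)
    (hxy1 : y - x ≤ 1) (hδ : 0 < δ)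
    (hHx : HasSum (fun i => hc i * x ^ i) Hx) (hHy : HasSum (fun i => hc i * y ^ i) Hy)
    (hgx : HasSum (fun i => b i * x ^ i) gx) (hgy : HasSum (fun i => b i * y ^ i) gy)
    (lo : ∀ i < l, hc i ≤ b i) (hi : ∀ i, l < i → b i ≤ hc i)
    (h1 : δ ≤ Hx) (h2 : Hy - Hx ≤ -δ * (y - x)) (h3 : gx ≤ ρ) (h4 : -ρ ≤ gy) :
    δ * (y - x) ≤ 2 * ρ := by
  by_cases hρ : ρ ≤ δ
  · have hfx := hgx.sub hHx
    have hfy := hgy.sub hHy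
    have hr : 1 ≤ y / x := (one_le_div hx).2 hxy
    have key : gy - Hy ≤ (y / x) ^ l * (gx - Hx) := by
      refine hasSum_le (fun i => ?_) hfy (hfx.mul_left _)
      have e : y ^ i = (y / x) ^ i * x ^ i := by
        rw [← mul_pow, div_mul_cancel₀ _ hx.ne']
      rw [e]
      have hxi : 0 < x ^ i := by positivity
      have : (b i - hc i) * (y / x) ^ i ≤ (b i - hc i) * (y / x) ^ l := by
        rcases lt_trichotomy i l with h | h | h
        · exact mul_le_mul_of_nonneg_left (pow_le_pow_right₀ hr h.le) (sub_nonneg.2 (lo i h))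
        · rw [h]
        · exact mul_le_mul_of_nonpos_left (pow_le_pow_right₀ hr h.le) (sub_nonpos.2 (hi i h))
      nlinarith [mul_le_mul_of_nonneg_right this hxi.le]
    have hneg : gx - Hx ≤ 0 := by linarith
    have : 1 ≤ (y / x) ^ l := one_le_pow₀ hr
    nlinarith
  · nlinarith

lemma abs_le_one_iff' {a : ℝ} : |a| ≤ 1 ↔ -1 ≤ a ∧ a ≤ 1 := abs_le

lemma transv_one : Transv Set.univ (Set.Icc (1 / 2) (63 / 100)) (3 / 100) := by
  intro n _ b hb hb0 _ x hx y hy hxy ρ hgx hgy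
  obtain ⟨hx1, hx2⟩ := hx
  obtain ⟨hy1, hy2⟩ := hy
  let H : ℝ → ℝ := fun x => (1 - x)⁻¹ - (2 * x + 2 * x ^ 2 + 2 * x ^ 3 + x ^ 4 / 2)
  let d : ℕ → ℝ := fun i => if i = 1 then 2 else if i = 2 then 2 else if i = 3 then 2 else
    if i = 4 then 1 / 2 else 0
  have hS : ∀ x : ℝ, 0 ≤ x → x < 1 → HasSum (fun i => (1 - d i) * x ^ i) (H x) := by
    intro x h0 h1
    have h := (hasSum_geometric_of_lt_one h0 h1).sub
      (hasSum_sum_of_ne_finset_zero (f := fun i => d i * x ^ i) (s := Finset.range 5) (by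
        intro i hi
        simp only [Finset.mem_range, not_lt] at hi
        have : d i = 0 := by simp only [d]; repeat rw [if_neg (by omega)]
        simp [this]))
    have e : H x = (1 - x)⁻¹ - ∑ i ∈ Finset.range 5, d i * x ^ i := by
      simp [Finset.sum_range_succ, d, H]; ring
    rw [e]
    simpa only [sub_mul, one_mul] using h
  have hanti : AntitoneOn (fun x => H x + 3 / 100 * x) (Set.Icc (1 / 2) (63 / 100)) := by
    have hd : ∀ x : ℝ, x < 1 → HasDerivAt (fun x => H x + 3 / 100 * x)
        (-(-1) / (1 - x) ^ 2 - (2 * 1 + 2 * (2 * x) + 2 * (3 * x ^ 2) + 4 * x ^ 3 / 2)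
          + 3 / 100 * 1) x := by
      intro x h
      have h' : (1 - x) ≠ 0 := by linarith
      have a1 := ((hasDerivAt_id x).const_sub 1).inv h'
      have a2 := (((((hasDerivAt_id x).const_mul 2).add ((hasDerivAt_pow 2 x).const_mul 2)).add
        ((hasDerivAt_pow 3 x).const_mul 2)).add ((hasDerivAt_pow 4 x).div_const 2))
      exact ((a1.sub a2).add ((hasDerivAt_id x).const_mul (3 / 100))).congr_deriv (by simp)
    refine antitoneOn_of_deriv_nonpos (convex_Icc _ _) ?_ ?_ ?_
    · intro x hx
      exact (hd x (by linarith [hx.2])).continuousAt.continuousWithinAt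
    · intro x hx
      rw [interior_Icc] at hx
      exact (hd x (by linarith [hx.2])).differentiableAt.differentiableWithinAt
    · intro x hx
      rw [interior_Icc] at hx
      obtain ⟨h1, h2⟩ := hx
      rw [(hd x (by linarith)).deriv]
      have hp : 0 < (1 - x) ^ 2 := by nlinarith
      have : -(-1) / (1 - x) ^ 2 ≤ 2 + 4 * x + 6 * x ^ 2 + 2 * x ^ 3 - 3 / 100 := by
        rw [div_le_iff₀ hp]
        have e1 : 0 ≤ (63/100 - x) := by linarith
        have e2 : 0 ≤ (x - 1/2) := by linarith
        nlinarith [mul_nonneg e1 e2, mul_nonneg (mul_nonneg e1 e2) e2, mul_nonneg (mul_nonneg e1 e2) e1, mul_nonneg (mul_nonneg (mul_nonneg e1 e2) e2) e1, mul_nonneg (mul_nonneg (mul_nonneg e1 e2) e2) e2, mul_nonneg (mul_nonneg (mul_nonneg (mul_nonneg e1 e2) e2) e2) e2, mul_nonneg (mul_nonneg (mul_nonneg (mul_nonneg e1 e2) e2) e2) e1]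
      linarith
  refine transv_core (hc := fun i => 1 - d i) (b := b) (l := 4) (Hx := H x) (Hy := H y)
    (by linarith) hxy (by linarith) (by norm_num) (hS x (by linarith) (by linarith))
    (hS y (by linarith) (by linarith))
    (summable_coeff hb (by linarith) (by linarith)).hasSum
    (summable_coeff hb (by linarith) (by linarith)).hasSum ?_ ?_ ?_ ?_ (abs_le.1 hgx).2
    (abs_le.1 hgy).1
  · intro i hi
    have := (abs_le.1 (hb i)).1
    interval_cases i <;> simp [d] <;> linarith
  · intro i hi
    have := (abs_le.1 (hb i)).2
    have h : d i = 0 := by simp only [d]; repeat rw [if_neg (by omega)]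
    simpa [h] using this
  · have := hanti ⟨hx1, hx2⟩ (Set.right_mem_Icc.2 (by norm_num)) hx2
    have e : (1 / 20 : ℝ) ≤ H (63 / 100) := by norm_num [H]
    simp only at this
    linarith
  · have := hanti ⟨hx1, hx2⟩ ⟨hy1, hy2⟩ hxy
    simp only at this
    linarith

lemma hasSum_periodic {χ : ℕ → ℝ} (hχ : ∀ i, |χ i| ≤ 1) (hp : ∀ i, χ (i + 3) = χ i) {x : ℝ}
    (h0 : 0 ≤ x) (h1 : x < 1) :
    HasSum (fun i => χ i * x ^ i) ((χ 0 + χ 1 * x + χ 2 * x ^ 2) / (1 - x ^ 3)) := by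
  have hs := summable_coeff hχ h0 h1
  have h := hs.sum_add_tsum_nat_add 3
  have e : ∀ i, χ (i + 3) * x ^ (i + 3) = x ^ 3 * (χ i * x ^ i) := fun i => by
    rw [hp, pow_add]; ring
  simp_rw [e, tsum_mul_left] at h
  have h3 : x ^ 3 < 1 := pow_lt_one₀ h0 h1 (by norm_num)
  convert hs.hasSum using 1
  rw [div_eq_iff (by linarith)]
  simp [Finset.sum_range_succ] at h
  linarith

lemma transv_two : Transv {k | k % 3 ≠ 2} (Set.Icc (63 / 100) (7072 / 10000)) (3 / 100) := by
  intro n hn b hb hb0 hbT x hx y hy hxy ρ hgx hgy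
  obtain ⟨hx1, hx2⟩ := hx
  obtain ⟨hy1, hy2⟩ := hy
  have hn' : n % 3 = 0 ∨ n % 3 = 1 := by
    have : n % 3 ≠ 2 := hn
    omega
  rcases hn' with hn' | hn'
  · have hz : ∀ i, i % 3 = 2 → b i = 0 := fun i hi => hbT i (by simp; omega)
    let H : ℝ → ℝ := fun x => (1 + x) / (1 - x ^ 3) - (2 * x + 2 * x ^ 3 + 195 / 100 * x ^ 4)
    let χ : ℕ → ℝ := fun i => if i % 3 = 2 then 0 else 1
    let d : ℕ → ℝ := fun i => if i = 1 then 2 else if i = 3 then 2 else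
      if i = 4 then 195 / 100 else 0
    have hS : ∀ x : ℝ, 0 ≤ x → x < 1 → HasSum (fun i => (χ i - d i) * x ^ i) (H x) := by
      intro x h0 h1
      have h := (hasSum_periodic (χ := χ) (fun i => by simp only [χ]; split_ifs <;> simp)
        (fun i => by simp [χ]) h0 h1).sub
        (hasSum_sum_of_ne_finset_zero (f := fun i => d i * x ^ i) (s := Finset.range 5) (by
          intro i hi
          simp only [Finset.mem_range, not_lt] at hi
          have : d i = 0 := by simp only [d]; repeat rw [if_neg (by omega)]
          simp [this]))
      have e : H x = (χ 0 + χ 1 * x + χ 2 * x ^ 2) / (1 - x ^ 3) -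
          ∑ i ∈ Finset.range 5, d i * x ^ i := by
        simp [Finset.sum_range_succ, d, H, χ]
      rw [e]
      simpa only [sub_mul, one_mul] using h
    have hanti : AntitoneOn (fun x => H x + 3 / 100 * x)
        (Set.Icc (63 / 100) (7072 / 10000)) := by
      have hlt : ∀ x : ℝ, 0 < x → x < 1 → 0 < 1 - x ^ 3 := fun x h0 h1 => by
        have := pow_lt_one₀ h0.le h1 (n := 3) (by norm_num)
        linarith
      have hd : ∀ x : ℝ, 0 < x → x < 1 → HasDerivAt (fun x => H x + 3 / 100 * x)
          ((1 * (1 - x ^ 3) - (1 + x) * (-(3 * x ^ 2))) / (1 - x ^ 3) ^ 2 -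
            (2 * 1 + 2 * (3 * x ^ 2) + 195 / 100 * (4 * x ^ 3)) + 3 / 100 * 1) x := by
        intro x h0 h
        have h' : (1 - x ^ 3) ≠ 0 := (hlt x h0 h).ne'
        have a1 := ((hasDerivAt_id x).const_add 1).div ((hasDerivAt_pow 3 x).const_sub 1) h'
        have a2 := ((((hasDerivAt_id x).const_mul 2).add ((hasDerivAt_pow 3 x).const_mul 2)).add
          ((hasDerivAt_pow 4 x).const_mul (195 / 100)))
        exact ((a1.sub a2).add ((hasDerivAt_id x).const_mul (3 / 100))).congr_deriv (by simp)
      refine antitoneOn_of_deriv_nonpos (convex_Icc _ _) ?_ ?_ ?_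
      · intro x hx
        exact (hd x (by linarith [hx.1]) (by linarith [hx.2])).continuousAt.continuousWithinAt
      · intro x hx
        rw [interior_Icc] at hx
        exact (hd x (by linarith [hx.1])
          (by linarith [hx.2])).differentiableAt.differentiableWithinAt
      · intro x hx
        rw [interior_Icc] at hx
        obtain ⟨h1, h2⟩ := hx
        rw [(hd x (by linarith) (by linarith)).deriv]
        have hp : 0 < (1 - x ^ 3) ^ 2 := by
          have := hlt x (by linarith) (by linarith)
          positivity
        have : (1 * (1 - x ^ 3) - (1 + x) * (-(3 * x ^ 2))) / (1 - x ^ 3) ^ 2 ≤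
            2 + 6 * x ^ 2 + 78 / 10 * x ^ 3 - 3 / 100 := by
          rw [div_le_iff₀ hp]
          have e1 : 0 ≤ (7072 / 10000 - x) := by linarith
          have e2 : 0 ≤ (x - 63 / 100) := by linarith
          have e (i j : ℕ) : 0 ≤ (7072 / 10000 - x) ^ i * (x - 63 / 100) ^ j := by positivity
          linarith [e 0 9, e 1 8, e 2 7, e 3 6, e 4 5, e 5 4, e 6 3, e 7 2, e 8 1, e 9 0]
        linarith
    refine transv_core (hc := fun i => χ i - d i) (b := b) (l := 4) (Hx := H x) (Hy := H y)
      (by linarith) hxy (by linarith) (by norm_num) (hS x (by linarith) (by linarith))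
      (hS y (by linarith) (by linarith))
      (summable_coeff hb (by linarith) (by linarith)).hasSum
      (summable_coeff hb (by linarith) (by linarith)).hasSum ?_ ?_ ?_ ?_ (abs_le.1 hgx).2
      (abs_le.1 hgy).1
    · intro i hi
      have := (abs_le.1 (hb i)).1
      have h2 := hz 2 rfl
      interval_cases i <;> simp [d, χ] <;> linarith
    · intro i hi
      have := (abs_le.1 (hb i)).2
      have h : d i = 0 := by simp only [d]; repeat rw [if_neg (by omega)]
      by_cases hi3 : i % 3 = 2
      · simp [h, χ, hi3, hz i hi3]
      · simpa [h, χ, hi3] using this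
    · have := hanti ⟨hx1, hx2⟩ (Set.right_mem_Icc.2 (by norm_num)) hx2
      have e : (3 / 100 : ℝ) ≤ H (7072 / 10000) := by norm_num [H]
      simp only at this
      linarith
    · have := hanti ⟨hx1, hx2⟩ ⟨hy1, hy2⟩ hxy
      simp only at this
      linarith
  · have hz : ∀ i, i % 3 = 1 → b i = 0 := fun i hi => hbT i (by simp; omega)
    let H : ℝ → ℝ := fun x => (1 + x ^ 2) / (1 - x ^ 3) - (2 * x ^ 2 + 2 * x ^ 3 + 2 * x ^ 5)
    let χ : ℕ → ℝ := fun i => if i % 3 = 1 then 0 else 1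
    let d : ℕ → ℝ := fun i => if i = 2 then 2 else if i = 3 then 2 else
      if i = 5 then 2 else 0
    have hS : ∀ x : ℝ, 0 ≤ x → x < 1 → HasSum (fun i => (χ i - d i) * x ^ i) (H x) := by
      intro x h0 h1
      have h := (hasSum_periodic (χ := χ) (fun i => by simp only [χ]; split_ifs <;> simp)
        (fun i => by simp [χ]) h0 h1).sub
        (hasSum_sum_of_ne_finset_zero (f := fun i => d i * x ^ i) (s := Finset.range 6) (by
          intro i hi
          simp only [Finset.mem_range, not_lt] at hi
          have : d i = 0 := by simp only [d]; repeat rw [if_neg (by omega)]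
          simp [this]))
      have e : H x = (χ 0 + χ 1 * x + χ 2 * x ^ 2) / (1 - x ^ 3) -
          ∑ i ∈ Finset.range 6, d i * x ^ i := by
        simp [Finset.sum_range_succ, d, H, χ]
      rw [e]
      simpa only [sub_mul, one_mul] using h
    have hanti : AntitoneOn (fun x => H x + 3 / 100 * x)
        (Set.Icc (63 / 100) (7072 / 10000)) := by
      have hlt : ∀ x : ℝ, 0 < x → x < 1 → 0 < 1 - x ^ 3 := fun x h0 h1 => by
        have := pow_lt_one₀ h0.le h1 (n := 3) (by norm_num)
        linarith
      have hd : ∀ x : ℝ, 0 < x → x < 1 → HasDerivAt (fun x => H x + 3 / 100 * x)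
          ((2 * x * (1 - x ^ 3) - (1 + x ^ 2) * (-(3 * x ^ 2))) / (1 - x ^ 3) ^ 2 -
            (2 * (2 * x) + 2 * (3 * x ^ 2) + 2 * (5 * x ^ 4)) + 3 / 100 * 1) x := by
        intro x h0 h
        have h' : (1 - x ^ 3) ≠ 0 := (hlt x h0 h).ne'
        have a1 := ((hasDerivAt_pow 2 x).const_add 1).div ((hasDerivAt_pow 3 x).const_sub 1) h'
        have a2 := ((((hasDerivAt_pow 2 x).const_mul 2).add
          ((hasDerivAt_pow 3 x).const_mul 2)).add ((hasDerivAt_pow 5 x).const_mul 2))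
        exact ((a1.sub a2).add ((hasDerivAt_id x).const_mul (3 / 100))).congr_deriv (by simp)
      refine antitoneOn_of_deriv_nonpos (convex_Icc _ _) ?_ ?_ ?_
      · intro x hx
        exact (hd x (by linarith [hx.1]) (by linarith [hx.2])).continuousAt.continuousWithinAt
      · intro x hx
        rw [interior_Icc] at hx
        exact (hd x (by linarith [hx.1])
          (by linarith [hx.2])).differentiableAt.differentiableWithinAt
      · intro x hx
        rw [interior_Icc] at hx
        obtain ⟨h1, h2⟩ := hx
        rw [(hd x (by linarith) (by linarith)).deriv]
        have hp : 0 < (1 - x ^ 3) ^ 2 := by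
          have := hlt x (by linarith) (by linarith)
          positivity
        have : (2 * x * (1 - x ^ 3) - (1 + x ^ 2) * (-(3 * x ^ 2))) / (1 - x ^ 3) ^ 2 ≤
            4 * x + 6 * x ^ 2 + 10 * x ^ 4 - 3 / 100 := by
          rw [div_le_iff₀ hp]
          have e1 : 0 ≤ (7072 / 10000 - x) := by linarith
          have e2 : 0 ≤ (x - 63 / 100) := by linarith
          have e (i j : ℕ) : 0 ≤ (7072 / 10000 - x) ^ i * (x - 63 / 100) ^ j := by positivity
          linarith [e 0 10, e 1 9, e 2 8, e 3 7, e 4 6, e 5 5, e 6 4, e 7 3, e 8 2, e 9 1, e 10 0]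
        linarith
    refine transv_core (hc := fun i => χ i - d i) (b := b) (l := 5) (Hx := H x) (Hy := H y)
      (by linarith) hxy (by linarith) (by norm_num) (hS x (by linarith) (by linarith))
      (hS y (by linarith) (by linarith))
      (summable_coeff hb (by linarith) (by linarith)).hasSum
      (summable_coeff hb (by linarith) (by linarith)).hasSum ?_ ?_ ?_ ?_ (abs_le.1 hgx).2
      (abs_le.1 hgy).1
    · intro i hi
      have := (abs_le.1 (hb i)).1
      have h2 := hz 1 rfl
      have h4 := hz 4 rfl
      interval_cases i <;> simp [d, χ] <;> linarith
    · intro i hi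
      have := (abs_le.1 (hb i)).2
      have h : d i = 0 := by simp only [d]; repeat rw [if_neg (by omega)]
      by_cases hi3 : i % 3 = 1
      · simp [h, χ, hi3, hz i hi3]
      · simpa [h, χ, hi3] using this
    · have := hanti ⟨hx1, hx2⟩ (Set.right_mem_Icc.2 (by norm_num)) hx2
      have e : (3 / 100 : ℝ) ≤ H (7072 / 10000) := by norm_num [H]
      simp only at this
      linarith
    · have := hanti ⟨hx1, hx2⟩ ⟨hy1, hy2⟩ hxy
      simp only at this
      linarith
lemma bern_apply (p₀ p₁ : ℝ) (b : Bool) :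
    bernoulliMeasure p₀ p₁ {b} = ENNReal.ofReal (if b then p₁ else p₀) := by
  cases b <;> simp [bernoulliMeasure]

lemma agree_bound (p₀ p₁ : ℕ → ℝ) (h₀ : ∀ k, 0 ≤ p₀ k) (h₁ : ∀ k, 0 ≤ p₁ k)
    (hsum : ∀ k, p₀ k + p₁ k = 1)
    (hsq : Summable fun k => (1 / 2 - p₀ k) ^ 2)
    (P : Measure (ℕ → Bool)) [IsProbabilityMeasure P]
    (hP : IsProductMeasure (fun k => bernoulliMeasure (p₀ k) (p₁ k)) P) (s : Finset ℕ) :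
    (P.prod P) {q | ∀ k ∈ s, q.1 k = q.2 k} ≤
      ENNReal.ofReal (Real.exp (4 * ∑' k, (1 / 2 - p₀ k) ^ 2) * (1 / 2) ^ s.card) := by
  classical
  let B : Finset ℕ → Set (ℕ → Bool) := fun A => {ω | ∀ k ∈ s, ω k ∈ ({decide (k ∈ A)} : Set Bool)}
  have hB : ∀ A ∈ s.powerset, P (B A) * P (B A) =
      (∏ k ∈ A, ENNReal.ofReal (p₁ k ^ 2)) * ∏ k ∈ s \ A, ENNReal.ofReal (p₀ k ^ 2) := by
    intro A hA
    rw [Finset.mem_powerset] at hA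
    have := hP s (fun k => {decide (k ∈ A)})
    simp only [B]
    rw [this, ← Finset.prod_mul_distrib, ← Finset.prod_sdiff hA, mul_comm]
    congr 1
    · refine Finset.prod_congr rfl fun k hk => ?_
      rw [bern_apply]
      simp [hk, ← ENNReal.ofReal_mul (h₁ k), sq]
    · refine Finset.prod_congr rfl fun k hk => ?_
      rw [bern_apply]
      have : k ∉ A := (Finset.mem_sdiff.1 hk).2
      simp [this, ← ENNReal.ofReal_mul (h₀ k), sq]
  have hsub : {q : (ℕ → Bool) × (ℕ → Bool) | ∀ k ∈ s, q.1 k = q.2 k} ⊆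
      ⋃ A ∈ s.powerset, B A ×ˢ B A := by
    rintro ⟨ω, τ⟩ hq
    simp only [Set.mem_iUnion]
    refine ⟨s.filter (fun k => ω k = true), by simp, ?_, ?_⟩
    · intro k hk
      simp [hk]
    · intro k hk
      have : ω k = τ k := hq k hk
      simp [hk, this]
  calc (P.prod P) {q | ∀ k ∈ s, q.1 k = q.2 k}
      ≤ ∑ A ∈ s.powerset, (P.prod P) (B A ×ˢ B A) :=
        (measure_mono hsub).trans (measure_biUnion_finset_le _ _)
    _ = ∑ A ∈ s.powerset,
        (∏ k ∈ A, ENNReal.ofReal (p₁ k ^ 2)) * ∏ k ∈ s \ A, ENNReal.ofReal (p₀ k ^ 2) := by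
        refine Finset.sum_congr rfl fun A hA => ?_
        rw [Measure.prod_prod, hB A hA]
    _ = ∏ k ∈ s, (ENNReal.ofReal (p₁ k ^ 2) + ENNReal.ofReal (p₀ k ^ 2)) :=
        (Finset.prod_add _ _ _).symm
    _ = ENNReal.ofReal (∏ k ∈ s, (p₁ k ^ 2 + p₀ k ^ 2)) := by
        rw [ENNReal.ofReal_prod_of_nonneg fun k _ => by positivity]
        refine Finset.prod_congr rfl fun k _ => ?_
        rw [ENNReal.ofReal_add (by positivity) (by positivity)]
    _ ≤ _ := by
        refine ENNReal.ofReal_le_ofReal ?_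
        calc ∏ k ∈ s, (p₁ k ^ 2 + p₀ k ^ 2)
            ≤ ∏ k ∈ s, (Real.exp (4 * (1 / 2 - p₀ k) ^ 2) * (1 / 2)) := by
              refine Finset.prod_le_prod (fun k _ => by positivity) fun k _ => ?_
              have e : p₁ k = 1 - p₀ k := by linarith [hsum k]
              have := Real.add_one_le_exp (4 * (1 / 2 - p₀ k) ^ 2)
              rw [e]
              nlinarith
          _ = Real.exp (4 * ∑ k ∈ s, (1 / 2 - p₀ k) ^ 2) * (1 / 2) ^ s.card := by
              rw [Finset.prod_mul_distrib, ← Real.exp_sum, Finset.mul_sum, Finset.prod_const]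
          _ ≤ _ := by
              gcongr
              exact hsq.sum_le_tsum s fun k _ => by positivity

open Classical in
/-- partial sums over an index set -/
noncomputable def partSum (S : Set ℕ) (t : ℝ) (ω : ℕ → Bool) : ℝ :=
  ∑' k : ℕ, if k ∈ S ∧ ω k = true then t ^ (k + 1) else 0

lemma measurable_coord (k : ℕ) (S : Set ℕ) : MeasurableSet {ω : ℕ → Bool | k ∈ S ∧ ω k = true} := by
  have h : MeasurableSet {ω : ℕ → Bool | ω k = true} :=
    (measurableSet_singleton true).preimage (measurable_pi_apply k)
  exact (MeasurableSet.const (k ∈ S)).inter h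

lemma measurable_partSum (S : Set ℕ) : Measurable (Function.uncurry (partSum S)) := by
  classical
  unfold partSum Function.uncurry
  refine Measurable.tsum fun k => ?_
  refine Measurable.ite ?_ (by fun_prop) measurable_const
  exact (measurable_coord k S).preimage measurable_snd

lemma measurable_partSum_gen {X : Type*} [MeasurableSpace X] (S : Set ℕ) (t : ℝ)
    (Y : X → ℕ → Bool) (hY : ∀ k ∈ S, Measurable fun x => Y x k) :
    Measurable fun x => partSum S t (Y x) := by
  classical
  unfold partSum
  refine Measurable.tsum fun k => ?_
  by_cases hk : k ∈ S
  · refine Measurable.ite ?_ measurable_const measurable_const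
    have h : MeasurableSet {x | Y x k = true} := (measurableSet_singleton true).preimage (hY k hk)
    exact (MeasurableSet.const (k ∈ S)).inter h
  · simp only [hk, false_and, if_false]
    exact measurable_const

lemma summable_part (S : Set ℕ) [DecidablePred (· ∈ S)] {t : ℝ} (h0 : 0 ≤ t) (h1 : t < 1)
    (ω : ℕ → Bool) :
    Summable fun k : ℕ => if k ∈ S ∧ ω k = true then t ^ (k + 1) else 0 := by
  refine Summable.of_nonneg_of_le (fun k => ?_) (fun k => ?_)
    ((summable_geometric_of_lt_one h0 h1).mul_left t)
  · split_ifs <;> positivity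
  · split_ifs
    · rw [pow_succ, mul_comm]
    · positivity

/-- digit coefficient -/
noncomputable def dig (T : Set ℕ) (m : ℕ) (ω : ℕ → Bool) (k : ℕ) : ℝ :=
  open Classical in if k ∈ T ∧ ω (m * k) = true then 1 else 0

lemma dig_abs (T : Set ℕ) (m : ℕ) (ω : ℕ → Bool) (k : ℕ) : |dig T m ω k| ≤ 1 := by
  unfold dig; split_ifs <;> simp

lemma partSum_image (T : Set ℕ) {m : ℕ} (hm : 0 < m) (t : ℝ) (ω : ℕ → Bool) :
    partSum ((fun k => m * k) '' T) t ω = t * ∑' k, dig T m ω k * (t ^ m) ^ k := by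
  classical
  have hinj : Function.Injective (fun k : ℕ => m * k) := fun a b h =>
    Nat.eq_of_mul_eq_mul_left hm h
  unfold partSum
  rw [← tsum_mul_left, ← hinj.tsum_eq]
  · refine tsum_congr fun k => ?_
    have : m * k ∈ (fun k => m * k) '' T ↔ k ∈ T := hinj.mem_set_image
    simp only [dig, this]
    split_ifs
    · rw [← pow_mul, pow_succ]; ring
    · simp
  · intro k hk
    simp only [Function.mem_support, ne_eq, ite_eq_right_iff, not_forall] at hk
    obtain ⟨⟨⟨j, _, rfl⟩, _⟩, _⟩ := hk
    exact ⟨j, rfl⟩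

lemma partSum_diff (T : Set ℕ) {m : ℕ} (hm : 0 < m) {t : ℝ} (h0 : 0 ≤ t) (h1 : t < 1)
    (ω τ : ℕ → Bool) (n : ℕ) (hn : n ∈ T) (hne : ω (m * n) ≠ τ (m * n))
    (hlt : ∀ k < n, k ∈ T → ω (m * k) = τ (m * k)) :
    |partSum ((fun k => m * k) '' T) t ω - partSum ((fun k => m * k) '' T) t τ| =
      t * (t ^ m) ^ n * |∑' i, ((dig T m ω n - dig T m τ n) *
        (dig T m ω (n + i) - dig T m τ (n + i))) * (t ^ m) ^ i| := by
  have hx0 : 0 ≤ t ^ m := by positivity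
  have hx1 : t ^ m < 1 := pow_lt_one₀ h0 h1 hm.ne'
  have s1 := summable_coeff (dig_abs T m ω) hx0 hx1
  have s2 := summable_coeff (dig_abs T m τ) hx0 hx1
  have hen : |dig T m ω n - dig T m τ n| = 1 := by
    unfold dig
    cases h : ω (m * n) <;> cases h' : τ (m * n) <;> simp_all
  rw [partSum_image T hm, partSum_image T hm, ← mul_sub, ← s1.tsum_sub s2]
  have s3 := s1.sub s2
  rw [← s3.sum_add_tsum_nat_add n]
  have z : ∑ i ∈ Finset.range n, (dig T m ω i * (t ^ m) ^ i - dig T m τ i * (t ^ m) ^ i) = 0 := by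
    refine Finset.sum_eq_zero fun i hi => ?_
    have : dig T m ω i = dig T m τ i := by
      unfold dig
      by_cases hT : i ∈ T
      · rw [hlt i (Finset.mem_range.1 hi) hT]
      · simp [hT]
    rw [this, sub_self]
  rw [z, zero_add]
  simp_rw [mul_assoc, tsum_mul_left]
  have e : ∀ i, dig T m ω (i + n) * (t ^ m) ^ (i + n) - dig T m τ (i + n) * (t ^ m) ^ (i + n) =
      (t ^ m) ^ n * ((dig T m ω (n + i) - dig T m τ (n + i)) * (t ^ m) ^ i) := fun i => by
    rw [add_comm i n, pow_add]; ring
  simp_rw [e, tsum_mul_left]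
  rw [abs_mul, abs_mul, abs_mul, hen, abs_of_nonneg h0, abs_of_nonneg (pow_nonneg hx0 n), one_mul]

lemma volume_bound (T : Set ℕ) {m : ℕ} (hm : 0 < m) {a b δ : ℝ} (ha : 0 < a) 
    (hδ : 0 < δ) (hT : Transv T (Set.Icc a b) δ) (ω τ : ℕ → Bool) (n : ℕ) (hn : n ∈ T)
    (hne : ω (m * n) ≠ τ (m * n)) (hlt : ∀ k < n, k ∈ T → ω (m * k) = τ (m * k)) (r : ℝ) :
    volume ({t | |partSum ((fun k => m * k) '' T) t ω - partSum ((fun k => m * k) '' T) t τ| ≤ r} ∩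
      {t | 1 / 2 ≤ t ∧ t < 1 ∧ t ^ m ∈ Set.Icc a b}) ≤
      ENNReal.ofReal (2 ^ m * 4 / δ * a⁻¹ ^ n * r) := by
  have key : ∀ t ∈ ({t | |partSum ((fun k => m * k) '' T) t ω -
      partSum ((fun k => m * k) '' T) t τ| ≤ r} ∩
      {t : ℝ | 1 / 2 ≤ t ∧ t < 1 ∧ t ^ m ∈ Set.Icc a b}),
      |∑' i, ((dig T m ω n - dig T m τ n) *
        (dig T m ω (n + i) - dig T m τ (n + i))) * (t ^ m) ^ i| ≤ 2 * a⁻¹ ^ n * r := by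
    rintro t ⟨hr, h1, h2, h3⟩
    have hr' : |partSum ((fun k => m * k) '' T) t ω -
      partSum ((fun k => m * k) '' T) t τ| ≤ r := hr
    rw [partSum_diff T hm (by linarith) h2 ω τ n hn hne hlt] at hr'
    have h5 : 1 / 2 * a ^ n ≤ t * (t ^ m) ^ n := by
      have := h3.1
      gcongr
    have h6 : 0 < a ^ n := by positivity
    have h7 := (mul_le_mul_of_nonneg_right h5 (abs_nonneg (∑' i, ((dig T m ω n - dig T m τ n) *
        (dig T m ω (n + i) - dig T m τ (n + i))) * (t ^ m) ^ i))).trans hr'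
    rw [inv_pow, ← div_eq_mul_inv, div_mul_eq_mul_div, le_div_iff₀ h6]
    linarith
  have main : ∀ t ∈ ({t | |partSum ((fun k => m * k) '' T) t ω -
      partSum ((fun k => m * k) '' T) t τ| ≤ r} ∩
      {t : ℝ | 1 / 2 ≤ t ∧ t < 1 ∧ t ^ m ∈ Set.Icc a b}), ∀ u ∈ ({t | |partSum ((fun k => m * k) '' T) t ω -
      partSum ((fun k => m * k) '' T) t τ| ≤ r} ∩
      {t : ℝ | 1 / 2 ≤ t ∧ t < 1 ∧ t ^ m ∈ Set.Icc a b}), t ≤ u → u - t ≤ 2 ^ m * 4 / δ * a⁻¹ ^ n * r := by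
    intro t ht u hu htu
    have k1 := key t ht
    have k2 := key u hu
    obtain ⟨_, t1, t2, t3⟩ := ht
    obtain ⟨_, u1, u2, u3⟩ := hu
    have hd : ∀ k, |dig T m ω k - dig T m τ k| ≤ 1 := by
      intro k
      unfold dig
      split_ifs <;> simp
    have hb := hT n hn (fun i => (dig T m ω n - dig T m τ n) *
        (dig T m ω (n + i) - dig T m τ (n + i))) (fun i => by
          rw [abs_mul]; exact mul_le_one₀ (hd _) (abs_nonneg _) (hd _)) (by
          simp only [dig, add_zero]
          cases h : ω (m * n) <;> cases h' : τ (m * n) <;> simp_all) (fun i hi => by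
          simp [dig, hi]) (t ^ m) t3 (u ^ m) u3
          (by gcongr) _ k1 k2
    obtain ⟨m', rfl⟩ : ∃ m', m = m' + 1 := ⟨m - 1, by omega⟩
    have g1 : (1 / 2 : ℝ) ^ (m' + 1) * (u - t) ≤ u ^ (m' + 1) - t ^ (m' + 1) := by
      have a1 : t ^ m' ≤ u ^ m' := by gcongr
      have a2 : (1 / 2 : ℝ) ^ m' ≤ t ^ m' := by gcongr
      have a3 : (0 : ℝ) < (1 / 2) ^ m' := by positivity
      rw [pow_succ, pow_succ, pow_succ]
      nlinarith
    have g2 : (2 : ℝ) ^ (m' + 1) * (1 / 2) ^ (m' + 1) = 1 := by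
      rw [← mul_pow]; norm_num
    have g3 : (0 : ℝ) < 2 ^ (m' + 1) := by positivity
    have g4 : δ * (u - t) ≤ 2 ^ (m' + 1) * (2 * (2 * a⁻¹ ^ n * r)) := by
      calc δ * (u - t) = 2 ^ (m' + 1) * (δ * ((1 / 2) ^ (m' + 1) * (u - t))) := by
            linear_combination (-δ * (u - t)) * g2
        _ ≤ 2 ^ (m' + 1) * (δ * (u ^ (m' + 1) - t ^ (m' + 1))) := by gcongr
        _ ≤ _ := by gcongr
    rw [div_mul_eq_mul_div, div_mul_eq_mul_div, le_div_iff₀ hδ]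
    linarith
  refine (Real.volume_le_diam _).trans (Metric.ediam_le fun t ht u hu => ?_)
  rw [edist_dist]
  refine ENNReal.ofReal_le_ofReal ?_
  rcases le_total t u with h | h
  · rw [dist_comm, Real.dist_eq, abs_of_nonneg (by linarith)]
    exact main t ht u hu h
  · rw [Real.dist_eq, abs_of_nonneg (by linarith)]
    exact main u hu t ht h

open Classical in
lemma ac_part (p₀ p₁ : ℕ → ℝ) (h₀ : ∀ k, 0 ≤ p₀ k) (h₁ : ∀ k, 0 ≤ p₁ k)
    (hsum : ∀ k, p₀ k + p₁ k = 1)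
    (hsq : Summable fun k => (1 / 2 - p₀ k) ^ 2)
    (P : Measure (ℕ → Bool)) [IsProbabilityMeasure P]
    (hP : IsProductMeasure (fun k => bernoulliMeasure (p₀ k) (p₁ k)) P)
    (T : Set ℕ) {m : ℕ} (hm : 0 < m) {a b δ : ℝ} (ha : 0 < a) (ha1 : a ≤ 1)
    (hδ : 0 < δ) (hT : Transv T (Set.Icc a b) δ)
    (hs : Summable fun n : ℕ => (1 / 2 : ℝ) ^ ((Finset.range n).filter (· ∈ T)).card * a⁻¹ ^ n) :
    ∀ᵐ t ∂(volume.restrict {t : ℝ | 1 / 2 ≤ t ∧ t < 1 ∧ t ^ m ∈ Set.Icc a b}),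
      P.map (partSum ((fun k => m * k) '' T) t) ≪ volume := by
  have hinj : Function.Injective (fun k : ℕ => m * k) := fun a b h =>
    Nat.eq_of_mul_eq_mul_left hm h
  let I : Set ℝ := {t : ℝ | 1 / 2 ≤ t ∧ t < 1 ∧ t ^ m ∈ Set.Icc a b}
  have hI : MeasurableSet I := by
    have e : I = Set.Ico (1 / 2) 1 ∩ (fun t : ℝ => t ^ m) ⁻¹' Set.Icc a b := by
      ext t; simp [I, and_assoc]
    rw [e]
    exact measurableSet_Ico.inter (measurableSet_Icc.preimage (by fun_prop))
  let s : ℕ → Finset ℕ := fun n => ((Finset.range n).filter (· ∈ T)).image (fun k => m * k)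
  let A : ℕ → Set ((ℕ → Bool) × (ℕ → Bool)) := fun n => {q | ∀ k ∈ s n, q.1 k = q.2 k}
  have hA : ∀ n, MeasurableSet (A n) := by
    intro n
    have : A n = ⋂ k ∈ s n, {q | q.1 k = q.2 k} := by ext q; simp [A]
    rw [this]
    refine Finset.measurableSet_biInter _ fun k _ => measurableSet_eq_fun ?_ ?_
    · exact (measurable_pi_apply k).comp measurable_fst
    · exact (measurable_pi_apply k).comp measurable_snd
  set c : ℝ := 2 ^ m * 4 / δ with hc
  have hcpos : 0 < c := by positivity
  set D : ℝ := Real.exp (4 * ∑' k, (1 / 2 - p₀ k) ^ 2) with hD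
  have hDpos : 0 < D := Real.exp_pos _
  have hs' : Summable fun n : ℕ =>
      (D * (1 / 2 : ℝ) ^ ((Finset.range n).filter (· ∈ T)).card) * (c * a⁻¹ ^ n) := by
    refine (hs.mul_left (D * c)).congr fun n => by ring
  refine ac_of_energy P (partSum ((fun k => m * k) '' T)) (measurable_partSum _) I
    (∑' n : ℕ, ENNReal.ofReal
      ((D * (1 / 2 : ℝ) ^ ((Finset.range n).filter (· ∈ T)).card) * (c * a⁻¹ ^ n)))
    hs'.tsum_ofReal_ne_top ?_
  intro r hr
  have hpt : ∀ q : (ℕ → Bool) × (ℕ → Bool), volume.restrict I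
      {t | |partSum ((fun k => m * k) '' T) t q.1 - partSum ((fun k => m * k) '' T) t q.2| ≤ r} ≤
      ∑' n, (A n).indicator (fun _ => ENNReal.ofReal (c * a⁻¹ ^ n * r)) q := by
    rintro ⟨ω, τ⟩
    by_cases hall : ∃ n, n ∈ T ∧ ω (m * n) ≠ τ (m * n)
    · let n := Nat.find hall
      have hn : n ∈ T ∧ ω (m * n) ≠ τ (m * n) := Nat.find_spec hall
      have hlt : ∀ k < n, k ∈ T → ω (m * k) = τ (m * k) := by
        intro k hk hkT
        by_contra hne
        exact Nat.find_min hall hk ⟨hkT, hne⟩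
      have hmem : (ω, τ) ∈ A n := by
        intro k hk
        simp only [s, Finset.mem_image, Finset.mem_filter, Finset.mem_range] at hk
        obtain ⟨j, ⟨hj1, hj2⟩, rfl⟩ := hk
        exact hlt j hj1 hj2
      rw [Measure.restrict_apply' hI]
      refine (volume_bound T hm ha hδ hT ω τ n hn.1 hn.2 hlt r).trans ?_
      refine le_trans ?_ (ENNReal.le_tsum n)
      rw [Set.indicator_of_mem hmem]
    · push Not at hall
      have hmem : ∀ n, (ω, τ) ∈ A n := by
        intro n k hk
        simp only [s, Finset.mem_image, Finset.mem_filter, Finset.mem_range] at hk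
        obtain ⟨j, ⟨hj1, hj2⟩, rfl⟩ := hk
        exact hall j hj2
      have htop : ∑' n, (A n).indicator (fun _ => ENNReal.ofReal (c * a⁻¹ ^ n * r)) (ω, τ) = ∞ := by
        rw [eq_top_iff]
        have hcr : ENNReal.ofReal (c * r) ≠ 0 := by
          simpa using mul_pos hcpos hr
        rw [← ENNReal.tsum_const_eq_top_of_ne_zero (α := ℕ) hcr]
        refine ENNReal.tsum_le_tsum fun n => ?_
        rw [Set.indicator_of_mem (hmem n)]
        refine ENNReal.ofReal_le_ofReal ?_
        have : 1 ≤ a⁻¹ ^ n := one_le_pow₀ ((one_le_inv₀ ha).2 ha1)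
        have := mul_pos hcpos hr
        nlinarith
      rw [htop]
      exact le_top
  calc _ ≤ ∫⁻ q, ∑' n, (A n).indicator (fun _ => ENNReal.ofReal (c * a⁻¹ ^ n * r)) q ∂(P.prod P) :=
        lintegral_mono hpt
    _ = ∑' n, ENNReal.ofReal (c * a⁻¹ ^ n * r) * (P.prod P) (A n) := by
        rw [lintegral_tsum fun n => (measurable_const.indicator (hA n)).aemeasurable]
        refine tsum_congr fun n => ?_
        rw [lintegral_indicator_const (hA n)]
    _ ≤ ∑' n : ℕ, ENNReal.ofReal
      ((D * (1 / 2 : ℝ) ^ ((Finset.range n).filter (· ∈ T)).card) * (c * a⁻¹ ^ n)) *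
        ENNReal.ofReal r := by
        refine ENNReal.tsum_le_tsum fun n => ?_
        have hb := agree_bound p₀ p₁ h₀ h₁ hsum hsq P hP (s n)
        rw [Finset.card_image_of_injective _ hinj, ← hD] at hb
        refine (mul_le_mul_right hb _).trans ?_
        rw [← ENNReal.ofReal_mul (by positivity), ← ENNReal.ofReal_mul (by positivity)]
        refine ENNReal.ofReal_le_ofReal (le_of_eq ?_)
        ring
    _ = _ := ENNReal.tsum_mul_right

open Classical in
lemma ac_full (p₀ p₁ : ℕ → ℝ) (h₀ : ∀ k, 0 ≤ p₀ k) (h₁ : ∀ k, 0 ≤ p₁ k)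
    (hsum : ∀ k, p₀ k + p₁ k = 1)
    (P : Measure (ℕ → Bool)) [IsProbabilityMeasure P]
    (hP : IsProductMeasure (fun k => bernoulliMeasure (p₀ k) (p₁ k)) P)
    (S : Set ℕ) {t : ℝ} (ht0 : 0 ≤ t) (ht1 : t < 1)
    (h : P.map (partSum S t) ≪ volume) :
    Measure.map (fun ω : ℕ → Bool => ∑' k : ℕ, if ω k then t ^ (k + 1) else 0) P
        ≪ volume := by
  have hprob : ∀ k, IsProbabilityMeasure (bernoulliMeasure (p₀ k) (p₁ k)) := by
    intro k
    constructor
    simp [bernoulliMeasure, ← ENNReal.ofReal_add (h₀ k) (h₁ k), hsum k]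
  have hPeq : P = Measure.infinitePi (fun k => bernoulliMeasure (p₀ k) (p₁ k)) := by
    refine Measure.eq_infinitePi _ fun s E _ => ?_
    rw [← hP s E]
    rfl
  have hsplit : (fun ω : ℕ → Bool => ∑' k : ℕ, if ω k then t ^ (k + 1) else 0) =
      partSum Sᶜ t + partSum S t := by
    funext ω
    simp only [Pi.add_apply, partSum]
    refine Eq.trans ?_
      ((@summable_part Sᶜ (fun _ => Classical.propDecidable _) _ ht0 ht1 ω).tsum_add
        (@summable_part S (fun _ => Classical.propDecidable _) _ ht0 ht1 ω))
    refine tsum_congr fun k => ?_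
    by_cases hk : k ∈ S <;> by_cases hw : ω k = true <;> simp [hk, hw]
  have hmeas : ∀ S : Set ℕ, Measurable (partSum S t) := fun S =>
    (measurable_partSum S).comp measurable_prodMk_left
  have hindep : ProbabilityTheory.IndepFun (partSum Sᶜ t) (partSum S t) P := by
    have hi : ProbabilityTheory.iIndepFun (fun k (ω : ℕ → Bool) => ω k) P := by
      rw [hPeq]
      exact ProbabilityTheory.iIndepFun_infinitePi (X := fun _ x => x) (fun _ => measurable_id)
    have hle : ∀ k, MeasurableSpace.comap (fun ω : ℕ → Bool => ω k) ⊤ ≤ MeasurableSpace.pi :=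
      fun k => (measurable_pi_apply k).comap_le
    have hI := ProbabilityTheory.indep_iSup_of_disjoint hle hi (S := Sᶜ) (T := S)
      (disjoint_compl_left)
    have hm : ∀ S : Set ℕ, MeasurableSpace.comap (partSum S t) inferInstance ≤
        ⨆ i ∈ S, MeasurableSpace.comap (fun ω : ℕ → Bool => ω i) ⊤ := by
      intro S
      refine Measurable.comap_le ?_
      refine @measurable_partSum_gen (ℕ → Bool)
        (⨆ i ∈ S, MeasurableSpace.comap (fun ω : ℕ → Bool => ω i) ⊤) S t id ?_
      intro k hk
      rw [measurable_iff_comap_le]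
      exact le_iSup₂_of_le k hk le_rfl
    have := ProbabilityTheory.indep_of_indep_of_le_left hI (hm Sᶜ)
    exact ProbabilityTheory.indep_of_indep_of_le_right this (hm S)
  rw [hsplit, hindep.map_add_eq_map_conv_map₀ (hmeas _).aemeasurable (hmeas _).aemeasurable]
  have : IsProbabilityMeasure (P.map (partSum S t)) :=
    Measure.isProbabilityMeasure_map (hmeas _).aemeasurable
  exact Measure.conv_absolutelyContinuous h

lemma card_filter_mod (n : ℕ) :
    ((Finset.range n).filter (fun k => k % 3 ≠ 2)).card + n / 3 = n := by
  induction n with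
  | zero => simp
  | succ n ih =>
    rw [Finset.range_add_one, Finset.filter_insert]
    split_ifs with h
    · rw [Finset.card_insert_of_notMem (by simp)]
      omega
    · omega

lemma exists_pow_mem {t : ℝ} (h0 : 1 / 2 < t) (h1 : t < 1) :
    ∃ m : ℕ, 0 < m ∧ 1 / 2 < t ^ m ∧ t ^ m ≤ 7072 / 10000 := by
  have hex : ∃ j : ℕ, t ^ (2 ^ j) ≤ 7072 / 10000 := by
    obtain ⟨n, hn⟩ := exists_pow_lt_of_lt_one (show (0 : ℝ) < 7072 / 10000 by norm_num) h1
    exact ⟨n, (pow_le_pow_of_le_one (by linarith) h1.le Nat.lt_two_pow_self.le).trans hn.le⟩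
  classical
  refine ⟨2 ^ Nat.find hex, by positivity, ?_, Nat.find_spec hex⟩
  rcases Nat.eq_zero_or_pos (Nat.find hex) with h | h
  · rw [h]; simpa using h0
  · obtain ⟨j, hj⟩ : ∃ j, Nat.find hex = j + 1 := ⟨Nat.find hex - 1, by omega⟩
    have hm := Nat.find_min hex (m := j) (by omega)
    push Not at hm
    rw [hj, pow_succ, pow_mul]
    nlinarith

lemma summable_two : Summable fun n : ℕ =>
    (1 / 2 : ℝ) ^ ((Finset.range n).filter (fun k => k % 3 ≠ 2)).card * (63 / 100 : ℝ)⁻¹ ^ n := by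
  set θ : ℝ := (1 / 2 : ℝ) ^ (2 / 3 : ℝ) with hθ
  have hθ0 : 0 < θ := by positivity
  have hθ3 : θ ^ 3 = 1 / 4 := by
    rw [hθ, ← Real.rpow_natCast, ← Real.rpow_mul (by norm_num)]
    norm_num
  have hθ1 : θ < 63 / 100 := by
    refine lt_of_pow_lt_pow_left₀ 3 (by norm_num) ?_
    rw [hθ3]; norm_num
  refine Summable.of_nonneg_of_le (fun n => by positivity) (fun n => ?_)
    (summable_geometric_of_lt_one (r := θ * (63 / 100)⁻¹) (by positivity) ?_)
  · rw [mul_pow]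
    gcongr
    refine le_of_pow_le_pow_left₀ (n := 3) (by norm_num) (by positivity) ?_
    rw [← pow_mul, ← pow_mul, mul_comm n 3, pow_mul θ, hθ3]
    have : (1 / 4 : ℝ) = (1 / 2) ^ 2 := by norm_num
    rw [this, ← pow_mul]
    refine pow_le_pow_of_le_one (by norm_num) (by norm_num) ?_
    have := card_filter_mod n
    omega
  · rw [← div_eq_mul_inv, div_lt_one (by norm_num)]
    exact hθ1

/-- If `∑ (1/2 - p₀ₖ)² < ∞`, then for Lebesgue-almost every `λ ∈ [1/2, 1)` the
distribution of `ψ = ∑_{k=1}^∞ ψₖ λᵏ` (where the `ψₖ` are independent with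
`P(ψₖ = 0) = p₀ₖ`, `P(ψₖ = 1) = p₁ₖ`) is absolutely continuous with respect to
Lebesgue measure on `ℝ`. -/
theorem absolutelyContinuous_of_summable_sq_half
    (p₀ p₁ : ℕ → ℝ) (h₀ : ∀ k, 0 ≤ p₀ k) (h₁ : ∀ k, 0 ≤ p₁ k)
    (hsum : ∀ k, p₀ k + p₁ k = 1)
    (hsq : Summable fun k => (1 / 2 - p₀ k) ^ 2)
    (P : Measure (ℕ → Bool))
    (hP : IsProductMeasure (fun k => bernoulliMeasure (p₀ k) (p₁ k)) P) :
    ∀ᵐ lam ∂(volume.restrict (Set.Ico (1 / 2 : ℝ) 1)),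
      Measure.map (fun ω : ℕ → Bool => ∑' k : ℕ, if ω k then lam ^ (k + 1) else 0) P
        ≪ volume := by
  have : IsProbabilityMeasure P := ⟨by simpa using hP ∅ (fun _ => Set.univ)⟩
  have c1 : ∀ m : ℕ, 0 < m → ∀ j : ℕ, ∀ᵐ t : ℝ, (1 / 2 ≤ t ∧ t < 1 ∧
      t ^ m ∈ Set.Icc (1 / 2 + 1 / ((j : ℝ) + 10)) (63 / 100)) →
      P.map (partSum ((fun k => m * k) '' Set.univ) t) ≪ volume := by
    intro m hm j
    have hj : (0 : ℝ) < 1 / ((j : ℝ) + 10) := by positivity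
    have hj' : 1 / ((j : ℝ) + 10) ≤ 1 / 10 :=
      one_div_le_one_div_of_le (by norm_num) (by linarith [Nat.cast_nonneg (α := ℝ) j])
    refine ae_imp_of_ae_restrict (s := {t : ℝ | 1 / 2 ≤ t ∧ t < 1 ∧
      t ^ m ∈ Set.Icc (1 / 2 + 1 / ((j : ℝ) + 10)) (63 / 100)}) ?_
    refine ac_part p₀ p₁ h₀ h₁ hsum hsq P hP Set.univ hm (δ := 3 / 100) (by linarith)
      (by linarith) (by norm_num) ?_ ?_
    · intro n hn b hb hb0 hbT x hx y hy
      exact transv_one n hn b hb hb0 hbT x ⟨by linarith [hx.1], hx.2⟩ y ⟨by linarith [hy.1], hy.2⟩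
    · have : (1 / 2) * (1 / 2 + 1 / ((j : ℝ) + 10))⁻¹ < 1 := by
        rw [← div_eq_mul_inv, div_lt_one (by linarith)]
        linarith
      refine (summable_geometric_of_lt_one (by positivity) this).congr fun n => ?_
      simp [mul_pow]
  have c2 : ∀ m : ℕ, 0 < m → ∀ᵐ t : ℝ, (1 / 2 ≤ t ∧ t < 1 ∧
      t ^ m ∈ Set.Icc (63 / 100) (7072 / 10000)) →
      P.map (partSum ((fun k => m * k) '' {k | k % 3 ≠ 2}) t) ≪ volume := by
    intro m hm
    refine ae_imp_of_ae_restrict (s := {t : ℝ | 1 / 2 ≤ t ∧ t < 1 ∧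
      t ^ m ∈ Set.Icc (63 / 100) (7072 / 10000)}) ?_
    refine ac_part p₀ p₁ h₀ h₁ hsum hsq P hP _ hm (δ := 3 / 100) (by norm_num)
      (by norm_num) (by norm_num) transv_two ?_
    convert summable_two
  have c1' : ∀ᵐ t : ℝ, ∀ m : ℕ, 0 < m → ∀ j : ℕ, (1 / 2 ≤ t ∧ t < 1 ∧
      t ^ m ∈ Set.Icc (1 / 2 + 1 / ((j : ℝ) + 10)) (63 / 100)) →
      P.map (partSum ((fun k => m * k) '' Set.univ) t) ≪ volume := by
    rw [ae_all_iff]; intro m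
    by_cases hm : 0 < m
    · simpa [hm, ae_all_iff] using c1 m hm
    · simp [hm]
  have c2' : ∀ᵐ t : ℝ, ∀ m : ℕ, 0 < m → (1 / 2 ≤ t ∧ t < 1 ∧
      t ^ m ∈ Set.Icc (63 / 100) (7072 / 10000)) →
      P.map (partSum ((fun k => m * k) '' {k | k % 3 ≠ 2}) t) ≪ volume := by
    rw [ae_all_iff]; intro m
    by_cases hm : 0 < m
    · simpa [hm] using c2 m hm
    · simp [hm]
  have c3 : ∀ᵐ t : ℝ, t ≠ 1 / 2 := by
    simp [ae_iff]
  rw [ae_restrict_iff' measurableSet_Ico]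
  filter_upwards [c1', c2', c3] with t g1 g2 g3 ht
  have ht2 : 1 / 2 < t := lt_of_le_of_ne ht.1 (Ne.symm g3)
  obtain ⟨m, hm, hm1, hm2⟩ := exists_pow_mem ht2 ht.2
  rcases le_total (t ^ m) (63 / 100) with h | h
  · obtain ⟨j, hj⟩ := exists_nat_one_div_lt (sub_pos.2 hm1)
    refine ac_full p₀ p₁ h₀ h₁ hsum P hP _ (by linarith) ht.2
      (g1 m hm j ⟨ht.1, ht.2, ?_, h⟩)
    have : 1 / ((j : ℝ) + 10) ≤ 1 / ((j : ℝ) + 1) :=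
      one_div_le_one_div_of_le (by positivity) (by linarith)
    linarith
  · exact ac_full p₀ p₁ h₀ h₁ hsum P hP _ (by linarith) ht.2
      (g2 m hm ⟨ht.1, ht.2, h, hm2⟩)
end

section
/- Suppose δ_k > 1 (i.e., a_k > r_k) for all k ∈ ℕ. Then the distribution of φ = Σ_{k=1}^∞ φ_k a_k is absolutely continuous with respect to Lebesgue measure on ℝ if and only if both Σ_{k=1}^∞ (δ_k − 1) < ∞ and Σ_{k=1}^∞ (1/2 − p_{0k})² < ∞. -/
open MeasureTheory

namespace BC
open Filter Topology

def rs (n : ℕ) (ω : ℕ → Bool) : Fin n → Bool := fun i => ω i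

lemma measurable_rs (n : ℕ) : Measurable (rs n) := by
  unfold rs; fun_prop

lemma measurableSet_lev (n : ℕ) (W : Set (Fin n → Bool)) : MeasurableSet (rs n ⁻¹' W) :=
  measurable_rs n (Set.toFinite W).measurableSet

lemma lev_sum (M : Measure (ℕ → Bool)) [IsFiniteMeasure M] (n : ℕ) (q : (Fin n → Bool) → ℝ)
    (hq : ∀ w, M.real (rs n ⁻¹' {w}) = q w) (W : Finset (Fin n → Bool)) :
    M.real (rs n ⁻¹' (W : Set (Fin n → Bool))) = ∑ w ∈ W, q w := by
  have : rs n ⁻¹' (W : Set (Fin n → Bool)) = ⋃ w ∈ W, rs n ⁻¹' {w} := by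
    ext ω; simp
  rw [this, measureReal_biUnion_finset]
  · exact Finset.sum_congr rfl fun w _ => hq w
  · intro v _ w _ hvw
    exact Disjoint.preimage _ (by simpa using hvw)
  · intro w _
    exact measurableSet_lev n _

def pr (p₀ p₁ : ℕ → ℝ) (k : ℕ) (b : Bool) : ℝ := if b then p₁ k else p₀ k

lemma open_eq (U : Set (ℕ → Bool)) (hU : IsOpen U) :
    ∃ W : ∀ n, Set (Fin n → Bool), Monotone (fun n => rs n ⁻¹' W n) ∧
      U = ⋃ n, rs n ⁻¹' W n := by
  refine ⟨fun n => {w | ∀ ω, rs n ω = w → ω ∈ U}, ?_, ?_⟩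
  · intro m n hmn ω hω ω' hω'
    refine hω ω' ?_
    ext i
    exact congrFun hω' ⟨i, i.2.trans_le hmn⟩
  · ext ω
    simp only [Set.mem_iUnion, Set.mem_preimage, Set.mem_ofPred_eq]
    constructor
    · intro h
      obtain ⟨v, ⟨x, n, rfl⟩, hv, hvU⟩ :=
        (PiNat.isTopologicalBasis_cylinders (fun _ => Bool)).exists_subset_of_mem_open h hU
      refine ⟨n, fun ω' h' => hvU ?_⟩
      rw [PiNat.mem_cylinder_iff] at hv ⊢
      intro i hi
      rw [← hv i hi]
      exact congrFun h' ⟨i, hi⟩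
    · rintro ⟨n, h⟩
      exact h ω rfl

section
variable (p₀ p₁ : ℕ → ℝ) (h₀ : ∀ k, 0 ≤ p₀ k) (h₁ : ∀ k, 0 ≤ p₁ k)
    (hp : ∀ k, p₀ k + p₁ k = 1) (P Q : Measure (ℕ → Bool)) [IsProbabilityMeasure P]
    [IsProbabilityMeasure Q]
    (hP : ∀ n w, P.real (rs n ⁻¹' {w}) = ∏ i : Fin n, pr p₀ p₁ i (w i))
    (hQ : ∀ n w, Q.real (rs n ⁻¹' {w}) = (1 / 2) ^ n)

include hp hP hQ in
lemma lev_bound (n : ℕ) (W : Set (Fin n → Bool)) :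
    P.real (rs n ⁻¹' W) ^ 2 ≤
      Real.exp (4 * ∑ k ∈ Finset.range n, (1 / 2 - p₀ k) ^ 2) * Q.real (rs n ⁻¹' W) := by
  classical
  obtain ⟨W, rfl⟩ : ∃ W' : Finset (Fin n → Bool), W = W' :=
    ⟨(Set.toFinite W).toFinset, by simp⟩
  rw [lev_sum P n _ (hP n), lev_sum Q n _ (hQ n)]
  have h2 : ∑ w ∈ W, (∏ i : Fin n, pr p₀ p₁ i (w i)) ^ 2 ≤
      ∏ i : Fin n, (p₀ i ^ 2 + p₁ i ^ 2) := by
    have e1 : ∑ w ∈ W, (∏ i : Fin n, pr p₀ p₁ i (w i)) ^ 2 ≤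
        ∑ w : Fin n → Bool, (∏ i : Fin n, pr p₀ p₁ i (w i)) ^ 2 :=
      Finset.sum_le_sum_of_subset_of_nonneg (Finset.subset_univ _) fun _ _ _ => sq_nonneg _
    have e2 := Fintype.prod_sum (fun (i : Fin n) (b : Bool) => (pr p₀ p₁ i b) ^ 2)
    refine e1.trans (le_of_eq ?_)
    simp only [← Finset.prod_pow]
    rw [← e2]
    refine Finset.prod_congr rfl fun i _ => ?_
    simp only [Fintype.sum_bool, pr, if_true, Bool.false_eq_true, if_false]
    ring
  have h3 : ∏ i : Fin n, (p₀ i ^ 2 + p₁ i ^ 2) ≤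
      Real.exp (4 * ∑ k ∈ Finset.range n, (1 / 2 - p₀ k) ^ 2) * (1 / 2) ^ n := by
    rw [Finset.mul_sum, Real.exp_sum, ← Fin.prod_univ_eq_prod_range (fun k => Real.exp (4 * (1 / 2 - p₀ k) ^ 2))]
    have : ((1:ℝ) / 2) ^ n = ∏ i : Fin n, (1 / 2 : ℝ) := by simp
    rw [this, ← Finset.prod_mul_distrib]
    refine Finset.prod_le_prod (fun _ _ => by positivity) fun i _ => ?_
    have := Real.add_one_le_exp (4 * (1 / 2 - p₀ i) ^ 2)
    have h' : p₁ i = 1 - p₀ i := by linarith [hp i]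
    rw [h']
    nlinarith
  have h4 := sq_sum_le_card_mul_sum_sq (s := W) (f := fun w => ∏ i : Fin n, pr p₀ p₁ i (w i))
  rw [Finset.sum_const, nsmul_eq_mul]
  calc _ ≤ _ := h4
    _ ≤ (W.card : ℝ) * (Real.exp (4 * ∑ k ∈ Finset.range n, (1 / 2 - p₀ k) ^ 2) * (1 / 2) ^ n) := by
        gcongr; exact h2.trans h3
    _ = _ := by ring

include hp hP hQ in
lemma kak_of_summable (hs : Summable fun k => (1 / 2 - p₀ k) ^ 2) : P ≪ Q := by
  set M := Real.exp (4 * ∑' k, (1 / 2 - p₀ k) ^ 2) with hM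
  have hM0 : 0 < M := Real.exp_pos _
  have hlev : ∀ n (W : Set (Fin n → Bool)),
      P.real (rs n ⁻¹' W) ^ 2 ≤ M * Q.real (rs n ⁻¹' W) := by
    intro n W
    refine (lev_bound p₀ p₁ hp P Q hP hQ n W).trans ?_
    have h4 := hs.sum_le_tsum (Finset.range n) fun _ _ => sq_nonneg _
    refine mul_le_mul_of_nonneg_right ?_ measureReal_nonneg
    rw [hM]
    exact Real.exp_le_exp.2 (by linarith)
  intro B hB
  by_contra hne
  have hpos : 0 < P.real B := by
    rw [measureReal_def]; exact ENNReal.toReal_pos hne (measure_ne_top _ _)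
  set t := P.real B with ht
  obtain ⟨U, hBU, hU, hlt⟩ := Set.exists_isOpen_lt_of_lt (μ := Q) B
    (ENNReal.ofReal (t ^ 2 / (4 * M))) (by rw [hB]; simp; positivity)
  obtain ⟨W, hmono, rfl⟩ := open_eq U hU
  have hle : P (⋃ n, rs n ⁻¹' W n) ≤ ENNReal.ofReal (t / 2) := by
    rw [hmono.measure_iUnion]
    refine iSup_le fun n => ?_
    rw [← ofReal_measureReal]
    apply ENNReal.ofReal_le_ofReal
    have h1 := hlev n (W n)
    have h2 : Q.real (rs n ⁻¹' W n) ≤ t ^ 2 / (4 * M) := by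
      rw [measureReal_def]
      refine ENNReal.toReal_le_of_le_ofReal (by positivity) ?_
      exact (measure_mono (Set.subset_iUnion (fun n => rs n ⁻¹' W n) n)).trans hlt.le
    have h3 : M * Q.real (rs n ⁻¹' W n) ≤ (t / 2) ^ 2 := by
      calc _ ≤ M * (t ^ 2 / (4 * M)) := by gcongr
        _ = _ := by field_simp; ring
    exact (pow_le_pow_iff_left₀ measureReal_nonneg (by positivity) two_ne_zero).1 (h1.trans h3)
  have h5 : P B ≤ ENNReal.ofReal (t / 2) := (measure_mono hBU).trans hle
  have h6 : t ≤ t / 2 := by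
    rw [ht, measureReal_def]
    exact ENNReal.toReal_le_of_le_ofReal (by positivity) h5
  linarith

include h₀ h₁ hp in
lemma hell_bound (n : ℕ) :
    ∑ w : Fin n → Bool, √((∏ i : Fin n, pr p₀ p₁ i (w i)) * (1 / 2) ^ n) ≤
      Real.exp (- ((∑ k ∈ Finset.range n, (1 / 2 - p₀ k) ^ 2) / 2)) := by
  classical
  have hpr : ∀ k b, 0 ≤ pr p₀ p₁ k b := by
    intro k b; unfold pr; split_ifs; exacts [h₁ k, h₀ k]
  have e1 : ∀ w : Fin n → Bool, √((∏ i : Fin n, pr p₀ p₁ i (w i)) * (1 / 2) ^ n) =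
      ∏ i : Fin n, √(pr p₀ p₁ i (w i) * (1 / 2)) := by
    intro w
    have : ((1:ℝ) / 2) ^ n = ∏ i : Fin n, (1 / 2 : ℝ) := by simp
    rw [this, ← Finset.prod_mul_distrib, Real.sqrt_prod]
    intro i _
    exact mul_nonneg (hpr _ _) (by norm_num)
  simp_rw [e1]
  rw [← Fintype.prod_sum (fun (i : Fin n) (b : Bool) => √(pr p₀ p₁ i b * (1 / 2))),
    Finset.sum_div, ← Finset.sum_neg_distrib, Real.exp_sum,
    ← Fin.prod_univ_eq_prod_range (fun k => Real.exp (-((1 / 2 - p₀ k) ^ 2 / 2)))]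
  refine Finset.prod_le_prod (fun _ _ => Finset.sum_nonneg fun _ _ => Real.sqrt_nonneg _) fun i _ => ?_
  simp only [Fintype.sum_bool, pr, if_true]
  have h' : p₁ i = 1 - p₀ i := by linarith [hp i]
  have hi0 := h₀ i
  have hi1 := h₁ i
  simp only [Bool.false_eq_true, if_false]
  rw [h'] at hi1 ⊢
  generalize p₀ (i : ℕ) = x at *
  have hsq : Real.exp (-((1 / 2 - x) ^ 2 / 2)) ^ 2 = Real.exp (-(1 / 2 - x) ^ 2) := by
    rw [← Real.exp_nat_mul]; congr 1; push_cast; ring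
  refine (pow_le_pow_iff_left₀ (by positivity) (Real.exp_pos _).le two_ne_zero).1 ?_
  rw [hsq]
  have hex := Real.add_one_le_exp (-(1 / 2 - x) ^ 2)
  have hA := Real.sq_sqrt (show 0 ≤ (1 - x) * (1 / 2) by linarith)
  have hB := Real.sq_sqrt (show 0 ≤ x * (1 / 2) by linarith)
  have hAB : √((1 - x) * (1 / 2)) * √(x * (1 / 2)) ≤ 1 / 4 - (1 / 2 - x) ^ 2 / 2 + 0 := by
    rw [← Real.sqrt_mul (by linarith)]
    apply Real.sqrt_le_iff.2
    constructor
    · nlinarith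
    · nlinarith [sq_nonneg ((1 / 2 - x) ^ 2)]
  nlinarith

include h₀ h₁ hp hP hQ in
lemma summable_of_kak (hac : P ≪ Q) : Summable fun k => (1 / 2 - p₀ k) ^ 2 := by
  classical
  by_contra hns
  have hT : Tendsto (fun n => ∑ k ∈ Finset.range n, (1 / 2 - p₀ k) ^ 2) atTop atTop :=
    (not_summable_iff_tendsto_nat_atTop_of_nonneg (fun _ => sq_nonneg _)).1 hns
  set ρ : ℕ → ℝ := fun n => Real.exp (- ((∑ k ∈ Finset.range n, (1 / 2 - p₀ k) ^ 2) / 2)) with hρ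
  have hρ0 : Tendsto ρ atTop (𝓝 0) := by
    apply Real.tendsto_exp_neg_atTop_nhds_zero.comp
    exact hT.atTop_div_const (by norm_num)
  have hpr : ∀ k b, 0 ≤ pr p₀ p₁ k b := by
    intro k b; unfold pr; split_ifs; exacts [h₁ k, h₀ k]
  let q : ∀ n, (Fin n → Bool) → ℝ := fun n w => ∏ i : Fin n, pr p₀ p₁ i (w i)
  have hq0 : ∀ n w, 0 ≤ q n w := fun n w => Finset.prod_nonneg fun i _ => hpr _ _
  let W : ∀ n, Finset (Fin n → Bool) := fun n => Finset.univ.filter fun w => (1 / 2) ^ n < q n w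
  have hQW : ∀ n, Q.real (rs n ⁻¹' (W n : Set (Fin n → Bool))) ≤ ρ n := by
    intro n
    rw [lev_sum Q n _ (hQ n)]
    refine le_trans ?_ (hell_bound p₀ p₁ h₀ h₁ hp n)
    refine le_trans (Finset.sum_le_sum (g := fun w => √(q n w * (1 / 2) ^ n)) ?_)
      (Finset.sum_le_sum_of_subset_of_nonneg (Finset.subset_univ _) fun _ _ _ => Real.sqrt_nonneg _)
    intro w hw
    have hw' : (1 / 2) ^ n < q n w := (Finset.mem_filter.1 hw).2
    apply Real.le_sqrt_of_sq_le
    rw [sq]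
    gcongr
  have hPW : ∀ n, P.real (rs n ⁻¹' (((W n)ᶜ : Finset _) : Set (Fin n → Bool))) ≤ ρ n := by
    intro n
    rw [lev_sum P n _ (hP n)]
    refine le_trans ?_ (hell_bound p₀ p₁ h₀ h₁ hp n)
    refine le_trans (Finset.sum_le_sum (g := fun w => √(q n w * (1 / 2) ^ n)) ?_)
      (Finset.sum_le_sum_of_subset_of_nonneg (Finset.subset_univ _) fun _ _ _ => Real.sqrt_nonneg _)
    intro w hw
    have hw' : q n w ≤ (1 / 2) ^ n := by
      by_contra hc
      exact (Finset.mem_compl.1 hw) (Finset.mem_filter.2 ⟨Finset.mem_univ _, not_le.1 hc⟩)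
    apply Real.le_sqrt_of_sq_le
    rw [sq]
    exact mul_le_mul_of_nonneg_left hw' (hq0 n w)
  have hQt : Tendsto (fun n => Q (rs n ⁻¹' (W n : Set (Fin n → Bool)))) atTop (𝓝 0) := by
    have h1 : Tendsto (fun n => ENNReal.ofReal (ρ n)) atTop (𝓝 0) := by
      simpa using ENNReal.tendsto_ofReal hρ0
    refine tendsto_of_tendsto_of_tendsto_of_le_of_le tendsto_const_nhds h1 (fun _ => zero_le) ?_
    intro n
    simp only
    rw [← ofReal_measureReal]
    exact ENNReal.ofReal_le_ofReal (hQW n)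
  have hPt : Tendsto (fun n => P (rs n ⁻¹' (W n : Set (Fin n → Bool)))) atTop (𝓝 0) := by
    have key := tendsto_setLIntegral_zero (μ := Q) (f := P.rnDeriv Q)
      (s := fun n => rs n ⁻¹' (W n : Set (Fin n → Bool))) (l := atTop)
      (Measure.lintegral_rnDeriv_lt_top P Q).ne hQt
    have : P.HaveLebesgueDecomposition Q := Measure.haveLebesgueDecomposition_of_sigmaFinite P Q
    have e : ∀ s, ∫⁻ x in s, P.rnDeriv Q x ∂Q = P s := fun s =>
      Measure.setLIntegral_rnDeriv hac s
    exact key.congr fun n => e _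
  have hPt' : Tendsto (fun n => P.real (rs n ⁻¹' (W n : Set (Fin n → Bool)))) atTop (𝓝 0) := by
    have := (ENNReal.tendsto_toReal ENNReal.zero_ne_top).comp hPt
    simpa [measureReal_def, Function.comp_def] using this
  have hsum := hPt'.add hρ0
  have : (1 : ℝ) ≤ 0 + 0 := by
    refine ge_of_tendsto hsum (Eventually.of_forall fun n => ?_)
    have h1 : P.real (rs n ⁻¹' (W n : Set (Fin n → Bool))) +
      P.real (rs n ⁻¹' (((W n)ᶜ : Finset _) : Set (Fin n → Bool))) = 1 := by
      rw [Finset.coe_compl, Set.preimage_compl,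
        probReal_compl_eq_one_sub (measurableSet_lev n _)]
      ring
    linarith [hPW n]
  norm_num at this

end
end BC

namespace BC
open Filter Topology

section geom
variable (a : ℕ → ℝ)

noncomputable def R (n : ℕ) : ℝ := ∑' i, a (i + n)
noncomputable def dg (ω : ℕ → Bool) (k : ℕ) : ℝ := if ω k then a k else 0
noncomputable def f (ω : ℕ → Bool) : ℝ := ∑' k, dg a ω k
noncomputable def g (n : ℕ) (ω : ℕ → Bool) : ℝ := ∑' k, dg a ω (k + n)
noncomputable def S (n : ℕ) (ω : ℕ → Bool) : ℝ := ∑ k ∈ Finset.range n, dg a ω k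

variable (ha : ∀ k, 0 < a k) (hs : Summable a) (hδ : ∀ k, R a (k + 1) < a k)

include hs in
lemma R_succ (n : ℕ) : R a n = a n + R a (n + 1) := by
  have h := (hs.comp_injective (add_left_injective n)).tsum_eq_zero_add
  simp only [Function.comp_def, zero_add] at h
  unfold R
  rw [h]
  congr 1
  refine tsum_congr fun i => ?_
  congr 1; omega

include ha hs in
lemma R_pos (n : ℕ) : 0 < R a n :=
  (hs.comp_injective (add_left_injective n)).tsum_pos (fun _ => (ha _).le) 0 (ha _)

include ha in
lemma dg_nonneg (ω k) : 0 ≤ dg a ω k := by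
  unfold dg; split_ifs; exacts [(ha k).le, le_rfl]

include ha in
lemma dg_le (ω k) : dg a ω k ≤ a k := by
  unfold dg; split_ifs; exacts [le_rfl, (ha k).le]

include ha hs in
lemma dg_summable (ω) : Summable (dg a ω) :=
  Summable.of_nonneg_of_le (dg_nonneg a ha ω) (dg_le a ha ω) hs

include ha hs in
lemma f_eq (n ω) : f a ω = S a n ω + g a n ω :=
  ((dg_summable a ha hs ω).sum_add_tsum_nat_add n).symm

include ha in
lemma g_nonneg (n ω) : 0 ≤ g a n ω := tsum_nonneg fun _ => dg_nonneg a ha _ _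

include ha hs in
lemma g_le (n ω) : g a n ω ≤ R a n :=
  Summable.tsum_le_tsum (fun _ => dg_le a ha _ _)
    ((dg_summable a ha hs ω).comp_injective (add_left_injective n))
    (hs.comp_injective (add_left_injective n))

include ha hs in
lemma f_cont : Continuous (f a) := by
  refine continuous_tsum (u := a) (fun i => ?_) hs fun n ω => ?_
  · have : Continuous (fun b : Bool => if b then a i else 0) := continuous_of_discreteTopology
    exact this.comp (continuous_apply i)
  · rw [Real.norm_of_nonneg (dg_nonneg a ha _ _)]; exact dg_le a ha _ _

include ha hs hδ in
lemma sep (n : ℕ) (ω ω' : ℕ → Bool) (h : rs n ω ≠ rs n ω') : R a n < |S a n ω - S a n ω'| := by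
  induction n with
  | zero => exact absurd (Subsingleton.elim _ _) h
  | succ n ih =>
    have hR := R_succ a hs n
    have hd := hδ n
    have hb1 := dg_nonneg a ha ω n
    have hb2 := dg_nonneg a ha ω' n
    have hb3 := dg_le a ha ω n
    have hb4 := dg_le a ha ω' n
    have e : S a (n + 1) ω - S a (n + 1) ω' = (S a n ω - S a n ω') + (dg a ω n - dg a ω' n) := by
      simp only [S, Finset.sum_range_succ]; ring
    rw [e]
    by_cases hn : rs n ω = rs n ω'
    · have hS : S a n ω = S a n ω' := by
        refine Finset.sum_congr rfl fun k hk => ?_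
        have : ω k = ω' k := congrFun hn ⟨k, Finset.mem_range.1 hk⟩
        simp [dg, this]
      have hne : ω n ≠ ω' n := by
        intro hc
        apply h
        ext i
        rcases Nat.lt_succ_iff_lt_or_eq.1 i.2 with hi | hi
        · exact congrFun hn ⟨i, hi⟩
        · simp only [rs, hi, hc]
      rw [hS, sub_self, zero_add]
      have : |dg a ω n - dg a ω' n| = a n := by
        unfold dg
        cases h1 : ω n <;> cases h2 : ω' n <;> simp_all [abs_of_pos]
      linarith
    · have := ih hn
      rcases lt_abs.1 this with h1 | h1
      · exact lt_of_lt_of_le (by linarith) (le_abs_self _)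
      · exact lt_of_lt_of_le (by linarith) (neg_le_abs _)

include ha hs hδ in
lemma f_inj : Function.Injective (f a) := by
  intro ω ω' h
  by_contra hne
  obtain ⟨n, hn⟩ := Function.ne_iff.1 hne
  have h1 := sep a ha hs hδ (n + 1) ω ω' (fun hc => hn (congrFun hc ⟨n, by omega⟩))
  have e1 := f_eq a ha hs (n + 1) ω
  have e2 := f_eq a ha hs (n + 1) ω'
  have b1 := g_nonneg a ha (n + 1) ω
  have b2 := g_nonneg a ha (n + 1) ω'
  have b3 := g_le a ha hs (n + 1) ω
  have b4 := g_le a ha hs (n + 1) ω'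
  rcases lt_abs.1 h1 with h1 | h1 <;> linarith

def ex (n : ℕ) (w : Fin n → Bool) (ω : ℕ → Bool) : ℕ → Bool :=
  fun k => if h : k < n then w ⟨k, h⟩ else ω k

lemma rs_ex (n w ω) : rs n (ex n w ω) = w := by
  ext i; simp [rs, ex]

lemma g_ex (n w ω) : g a n (ex n w ω) = g a n ω := by
  simp [g, dg, ex]

lemma S_rs (n ω ω') (h : rs n ω = rs n ω') : S a n ω = S a n ω' := by
  refine Finset.sum_congr rfl fun k hk => ?_
  have : ω k = ω' k := congrFun h ⟨k, Finset.mem_range.1 hk⟩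
  simp [dg, this]

/-- left endpoints -/
noncomputable def L (n : ℕ) (w : Fin n → Bool) : ℝ := S a n (ex n w fun _ => false)

include ha hs in
lemma image_cyl (n w) : f a '' (rs n ⁻¹' {w}) = (fun x => L a n w + x) '' Set.range (g a n) := by
  ext x
  constructor
  · rintro ⟨ω, rfl, rfl⟩
    refine ⟨_, ⟨ω, rfl⟩, ?_⟩
    rw [f_eq a ha hs n ω]
    simp only [L]
    rw [S_rs a n ω _ (rs_ex n _ _).symm]
  · rintro ⟨_, ⟨ω, rfl⟩, rfl⟩
    refine ⟨ex n w ω, rs_ex n w ω, ?_⟩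
    rw [f_eq a ha hs n, g_ex, S_rs a n (ex n w ω) (ex n w fun _ => false) (by rw [rs_ex, rs_ex])]
    rfl

def C (n : ℕ) : Set ℝ := ⋃ w ∈ (Finset.univ : Finset (Fin n → Bool)), Set.Icc (L a n w) (L a n w + R a n)

include ha hs hδ in
lemma vol_C (n : ℕ) : volume (C a n) = ENNReal.ofReal (2 ^ n * R a n) := by
  unfold C
  rw [measure_biUnion_finset]
  · simp [ENNReal.ofReal_mul]
  · intro v _ w _ hvw
    have := sep a ha hs hδ n (ex n v fun _ => false) (ex n w fun _ => false) (by simpa [rs_ex] using hvw)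
    refine Set.disjoint_left.2 fun x hx hx' => ?_
    have h1 := hx.1
    have h2 := hx.2
    have h3 := hx'.1
    have h4 := hx'.2
    unfold L at h1 h2 h3 h4
    rcases lt_abs.1 this with h | h <;> linarith
  · intro w _; exact measurableSet_Icc

include ha hs in
lemma range_sub_C (n : ℕ) : Set.range (f a) ⊆ C a n := by
  rintro _ ⟨ω, rfl⟩
  refine Set.mem_biUnion (x := rs n ω) (by simp) ?_
  have e : L a n (rs n ω) = S a n ω := S_rs a n _ _ (rs_ex n _ _)
  rw [e, f_eq a ha hs n ω]
  exact ⟨by linarith [g_nonneg a ha n ω], by linarith [g_le a ha hs n ω]⟩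

include ha hs in
lemma C_sub_thick (n : ℕ) : C a n ⊆ Metric.cthickening (R a n) (Set.range (f a)) := by
  intro x hx
  obtain ⟨w, -, hw⟩ := Set.mem_iUnion₂.1 hx
  refine Metric.mem_cthickening_of_dist_le x (f a (ex n w fun _ => false)) _ _ ⟨_, rfl⟩ ?_
  have : f a (ex n w fun _ => false) = L a n w := by
    rw [f_eq a ha hs n, g_ex]
    simp [L, g, dg]
  rw [this, Real.dist_eq, abs_of_nonneg (by linarith [hw.1])]
  linarith [hw.2]

include ha hs hδ in
lemma vol_le (n : ℕ) : volume (Set.range (f a)) ≤ ENNReal.ofReal (2 ^ n * R a n) := by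
  rw [← vol_C a ha hs hδ]; exact measure_mono (range_sub_C a ha hs n)

include ha hs hδ in
lemma le_vol (c : ℝ) (hc : ∀ n, c ≤ 2 ^ n * R a n) :
    ENNReal.ofReal c ≤ volume (Set.range (f a)) := by
  have h1 := (tendsto_measure_cthickening_of_isCompact (μ := (volume : Measure ℝ))
    (isCompact_range (f_cont a ha hs))).comp (tendsto_sum_nat_add a)
  refine ge_of_tendsto' h1 fun n => ?_
  refine (ENNReal.ofReal_le_ofReal (hc n)).trans ?_
  rw [← vol_C a ha hs hδ]
  exact measure_mono (C_sub_thick a ha hs n)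

include ha hs in
lemma c_eq (n : ℕ) : (2 ^ n * R a n) * ∏ k ∈ Finset.range n, (1 + (a k / R a (k + 1) - 1) / 2) = R a 0 := by
  induction n with
  | zero => simp
  | succ n ih =>
    rw [← ih, Finset.prod_range_succ, R_succ a hs n]
    have := (R_pos a ha hs (n + 1)).ne'
    field_simp
    ring

include ha hs hδ in
lemma vol_pos_iff (h0 : R a 0 = 1) :
    volume (Set.range (f a)) ≠ 0 ↔ Summable fun k => a k / R a (k + 1) - 1 := by
  have hε : ∀ k, 0 ≤ a k / R a (k + 1) - 1 := fun k => by
    rw [sub_nonneg, one_le_div (R_pos a ha hs _)]; exact (hδ k).le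
  have hcpos : ∀ n, 0 < 2 ^ n * R a n := fun n => mul_pos (by positivity) (R_pos a ha hs n)
  have hceq := c_eq a ha hs
  rw [h0] at hceq
  constructor
  · intro hV
    have hfin : volume (Set.range (f a)) ≠ ⊤ :=
      ((vol_le a ha hs hδ 0).trans_lt ENNReal.ofReal_lt_top).ne
    set v := (volume (Set.range (f a))).toReal with hv
    have hvpos : 0 < v := ENNReal.toReal_pos hV hfin
    have hvle : ∀ n, v ≤ 2 ^ n * R a n := fun n =>
      ENNReal.toReal_le_of_le_ofReal (hcpos n).le (vol_le a ha hs hδ n)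
    refine summable_of_sum_range_le (c := 2 / v) hε fun n => ?_
    have hprod : ∀ m, 1 + (∑ k ∈ Finset.range m, (a k / R a (k + 1) - 1)) / 2 ≤
        ∏ k ∈ Finset.range m, (1 + (a k / R a (k + 1) - 1) / 2) := by
      intro m
      induction m with
      | zero => simp
      | succ m ih =>
        rw [Finset.sum_range_succ, Finset.prod_range_succ]
        have := hε m
        have hS : 0 ≤ ∑ k ∈ Finset.range m, (a k / R a (k + 1) - 1) :=
          Finset.sum_nonneg fun k _ => hε k
        have h2 := mul_le_mul_of_nonneg_right ih
          (show 0 ≤ 1 + (a m / R a (m + 1) - 1) / 2 by linarith)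
        nlinarith [mul_nonneg hS this]
    have h1 := hceq n
    have h2 := hvle n
    have h3 := hprod n
    have hS : 0 ≤ ∑ k ∈ Finset.range n, (a k / R a (k + 1) - 1) :=
          Finset.sum_nonneg fun k _ => hε k
    rw [le_div_iff₀ hvpos]
    have h4 : v * (1 + (∑ k ∈ Finset.range n, (a k / R a (k + 1) - 1)) / 2) ≤ 1 := by
      refine le_trans ?_ h1.le
      exact mul_le_mul h2 h3 (by linarith) (hcpos n).le
    nlinarith
  · intro hsum
    set T := ∑' k, (a k / R a (k + 1) - 1)
    have := le_vol a ha hs hδ (Real.exp (-(T / 2))) fun n => ?_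
    · intro h
      rw [h] at this
      have h3 := ENNReal.ofReal_eq_zero.1 (le_antisymm this zero_le)
      exact absurd h3 (not_le.2 (Real.exp_pos _))
    · have hprod : ∏ k ∈ Finset.range n, (1 + (a k / R a (k + 1) - 1) / 2) ≤ Real.exp (T / 2) := by
        calc _ ≤ ∏ k ∈ Finset.range n, Real.exp ((a k / R a (k + 1) - 1) / 2) :=
              Finset.prod_le_prod (fun k _ => by linarith [hε k]) fun k _ => by
                linarith [Real.add_one_le_exp ((a k / R a (k + 1) - 1) / 2)]
          _ = Real.exp ((∑ k ∈ Finset.range n, (a k / R a (k + 1) - 1)) / 2) := by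
              rw [← Real.exp_sum, Finset.sum_div]
          _ ≤ _ := by
              apply Real.exp_le_exp.2
              have := hsum.sum_le_tsum (Finset.range n) fun k _ => hε k
              linarith
      have h1 := hceq n
      rw [Real.exp_neg, inv_le_iff_one_le_mul₀ (Real.exp_pos _), ← h1]
      exact mul_le_mul_of_nonneg_left hprod (hcpos n).le

include ha hs hδ in
lemma f_emb : MeasurableEmbedding (f a) :=
  ((f_cont a ha hs).isClosedEmbedding (f_inj a ha hs hδ)).measurableEmbedding

include ha hs hδ in
lemma comap_cyl (n w) : 2 ^ n * (Measure.comap (f a) volume) (rs n ⁻¹' {w}) =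
    volume (Set.range (f a)) := by
  have hc : ∀ w, (Measure.comap (f a) volume) (rs n ⁻¹' {w}) = volume (Set.range (g a n)) := by
    intro w
    rw [(f_emb a ha hs hδ).comap_apply, image_cyl a ha hs]
    simp
  have hU : (Set.univ : Set (ℕ → Bool)) = ⋃ w ∈ (Finset.univ : Finset (Fin n → Bool)), rs n ⁻¹' {w} := by
    ext ω; simp
  rw [← Set.image_univ, ← (f_emb a ha hs hδ).comap_apply, hU, measure_biUnion_finset]
  · simp [hc]
  · intro v _ w _ hvw
    exact Disjoint.preimage _ (by simpa using hvw)
  · intro w _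
    exact measurableSet_lev n _

end geom
end BC

/-- Suppose `a k > r k` (i.e. `δ k > 1`) for all `k`, where `r k = ∑_{i > k} a i` is the
tail of the positive series `∑ a k = 1`.  The distribution of `φ = ∑ φₖ aₖ` (where the
`φₖ` are independent with `P(φₖ = 0) = p₀ₖ`, `P(φₖ = 1) = p₁ₖ`) is absolutely
continuous with respect to Lebesgue measure on `ℝ` if and only if both
`∑ (δ k - 1) < ∞` (with `δ k = a k / r k`) and `∑ (1/2 - p₀ₖ)² < ∞`. -/
theorem distribution_absolutelyContinuous_iff
    (a : ℕ → ℝ) (ha : ∀ k, 0 < a k) (hsum : ∑' k, a k = 1)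
    (r : ℕ → ℝ) (hr : ∀ k, r k = ∑' i : ℕ, a (k + 1 + i))
    (hδ : ∀ k, r k < a k)
    (p₀ p₁ : ℕ → ℝ) (h₀ : ∀ k, 0 ≤ p₀ k) (h₁ : ∀ k, 0 ≤ p₁ k)
    (hp : ∀ k, p₀ k + p₁ k = 1)
    (P : Measure (ℕ → Bool))
    (hP : IsProductMeasure (fun k => bernoulliMeasure (p₀ k) (p₁ k)) P)
    (μφ : Measure ℝ)
    (hμφ : μφ = Measure.map (fun ω : ℕ → Bool => ∑' k : ℕ, if ω k then a k else 0) P) :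
    μφ ≪ volume ↔
      (Summable fun k => a k / r k - 1) ∧ (Summable fun k => (1 / 2 - p₀ k) ^ 2) := by
  have hs : Summable a := by
    by_contra h
    rw [tsum_eq_zero_of_not_summable h] at hsum
    norm_num at hsum
  have hrR : ∀ k, r k = BC.R a (k + 1) := by
    intro k
    rw [hr]
    exact tsum_congr fun i => by rw [add_comm]
  simp only [hrR] at hδ ⊢
  have hμ : μφ = Measure.map (BC.f a) P := hμφ
  have hP1 : IsProbabilityMeasure P := by
    constructor
    have := hP ∅ (fun _ => Set.univ)
    simpa using this
  have hPc : ∀ n w, P.real (BC.rs n ⁻¹' {w}) = ∏ i : Fin n, BC.pr p₀ p₁ i (w i) := by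
    intro n w
    have h := hP (Finset.range n) (fun k => {BC.ex n w (fun _ => false) k})
    have e : {ω : ℕ → Bool | ∀ k ∈ Finset.range n, ω k ∈ ({BC.ex n w (fun _ => false) k} : Set Bool)}
        = BC.rs n ⁻¹' {w} := by
      ext ω
      simp only [Finset.mem_range, Set.mem_singleton_iff, Set.mem_ofPred_eq, Set.mem_preimage]
      constructor
      · intro h
        ext i
        have := h i i.2
        simpa [BC.rs, BC.ex] using this
      · rintro rfl k hk
        simp [BC.rs, BC.ex, hk]
    rw [e] at h
    rw [measureReal_def, h, ENNReal.toReal_prod, ← Fin.prod_univ_eq_prod_range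
      (fun k => (bernoulliMeasure (p₀ k) (p₁ k) {BC.ex n w (fun _ => false) k}).toReal)]
    refine Finset.prod_congr rfl fun i _ => ?_
    have : BC.ex n w (fun _ => false) i = w i := by simp [BC.ex]
    rw [this]
    cases w i <;> simp [bernoulliMeasure, BC.pr, h₀, h₁]
  have hemb := BC.f_emb a ha hs hδ
  set ν := Measure.comap (BC.f a) volume with hν
  have hiff : μφ ≪ volume ↔ P ≪ ν := by
    rw [hμ]
    constructor
    · intro h B hB
      rw [hν, hemb.comap_apply] at hB
      have := h hB
      rwa [hemb.map_apply, hemb.injective.preimage_image] at this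
    · intro h A hA
      rw [hemb.map_apply]
      apply h
      rw [hν, hemb.comap_apply]
      exact measure_mono_null (Set.image_preimage_subset _ _) hA
  rw [hiff, ← BC.vol_pos_iff a ha hs hδ (by simpa [BC.R] using hsum)]
  have hνu : ν Set.univ = volume (Set.range (BC.f a)) := by
    rw [hν, hemb.comap_apply, Set.image_univ]
  set V := volume (Set.range (BC.f a)) with hV
  have hVfin : V ≠ ⊤ := ((BC.vol_le a ha hs hδ 0).trans_lt ENNReal.ofReal_lt_top).ne
  by_cases hV0 : V = 0
  · simp only [hV0, ne_eq, not_true_eq_false, false_and, iff_false]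
    intro h
    have := h (hνu.trans hV0)
    simp at this
  have hVinv : V⁻¹ ≠ 0 := ENNReal.inv_ne_zero.2 hVfin
  have hQ1 : IsProbabilityMeasure (V⁻¹ • ν) := by
    constructor
    rw [Measure.smul_apply, hνu, smul_eq_mul, ENNReal.inv_mul_cancel hV0 hVfin]
  have hQc : ∀ n w, (V⁻¹ • ν).real (BC.rs n ⁻¹' {w}) = (1 / 2) ^ n := by
    intro n w
    have h := congrArg ENNReal.toReal (BC.comap_cyl a ha hs hδ n w)
    rw [← hν, ← hV, ENNReal.toReal_mul] at h
    have hVr : V.toReal ≠ 0 := (ENNReal.toReal_pos hV0 hVfin).ne'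
    rw [measureReal_def, Measure.smul_apply, smul_eq_mul, ENNReal.toReal_mul, ENNReal.toReal_inv,
      ← h]
    rw [← h] at hVr
    simp only [ENNReal.toReal_pow, ENNReal.toReal_ofNat] at hVr ⊢
    have := right_ne_zero_of_mul hVr
    field_simp
    rw [← mul_pow]; norm_num
  have hsm : P ≪ ν ↔ P ≪ V⁻¹ • ν :=
    ⟨fun h => h.trans (Measure.absolutelyContinuous_smul hVinv),
      fun h => h.trans Measure.smul_absolutelyContinuous⟩
  rw [hsm]
  exact ⟨fun h => ⟨hV0, BC.summable_of_kak p₀ p₁ h₀ h₁ hp P _ hPc hQc h⟩,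
    fun h => BC.kak_of_summable p₀ p₁ hp P _ hPc hQc h.2⟩
end
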